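/- arXiv:1705.04205 — 2 statements merged into one kernel-verified Lean document; each statement's English description precedes it below -/
import Mathlib

section
/- Let k ≥ 2 be an even integer and s an integer with s ≥ k, and set r = s/k. There exist absolute constants ε₀ > 0, C > 0 and N₀ such that the following holds. Suppose n and n_R are positive integers with k²·n = 625·s²·n_R, n_L = n − n_R, N₀·s ≤ √n_R, and n ≥ N₀·r⁴, and let f be the hard function built from any balanced-blocks function on (Fin n_R → Bool) with 3s blocks. Then for every permutation σ of Fin n: (i) for every s-monotone function g : (Fin n → Bool) → Bool, the function f∘π_σ (where π_σ(z) = z∘σ) satisfies d(f∘π_σ, g) ≥ ε₀; and (ii) the probability that a uniformly random maximal chain in {0,1}^n contains a violation of k-monotonicity of f∘π_σ is at most exp(−C·(k²/s²)·√n). -/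
/-- A point of the hypercube `{0,1}^n`. -/
abbrev Pt (n : ℕ) := Fin n → Bool

/-- The weight `|x|` of a point: the number of coordinates set to `true`. -/
def wt {n : ℕ} (x : Pt n) : ℕ := (Finset.univ.filter (fun i => x i = true)).card

/-- The partial order `x ≼ y` on the hypercube. -/
def ple {n : ℕ} (x y : Pt n) : Prop := ∀ i, x i ≤ y i

/-- The strict order `x ≺ y` on the hypercube. -/
def plt {n : ℕ} (x y : Pt n) : Prop := ple x y ∧ x ≠ y

/-- `f` is `k`-monotone: there is no chain `x 0 ≺ x 1 ≺ ⋯ ≺ x k` with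
`f (x 0) = true` and `f` alternating along the chain. -/
def IsKMono {n : ℕ} (k : ℕ) (f : Pt n → Bool) : Prop :=
  ¬ ∃ x : ℕ → Pt n, (∀ i < k, plt (x i) (x (i + 1))) ∧ f (x 0) = true ∧
      ∀ i < k, f (x i) ≠ f (x (i + 1))

/-- The normalized Hamming distance `d(f,g)`. -/
noncomputable def hdist {n : ℕ} (f g : Pt n → Bool) : ℝ :=
  ({x : Pt n | f x ≠ g x}.ncard : ℝ) / 2 ^ n

/-- `b : ℕ → ℕ` describes a balanced-blocks partition of `{0,1}^m` into `ℓ` blocks: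
the `i`-th interval of levels (0-indexed) is `I_{i+1} = [b i, b (i+1))`, these intervals
are nonempty and partition `{0,…,m}`, and each block
`B_{i+1} = {y : b i ≤ |y| < b (i+1)}` has size within a `(1 ± ℓ/√m)` factor of `2^m/ℓ`. -/
def IsBBPartition (m ℓ : ℕ) (b : ℕ → ℕ) : Prop :=
  b 0 = 0 ∧ b ℓ = m + 1 ∧ (∀ i < ℓ, b i < b (i + 1)) ∧
  ∀ i < ℓ,
    (1 - ℓ / Real.sqrt m) * 2 ^ m / ℓ ≤
        ({y : Pt m | b i ≤ wt y ∧ wt y < b (i + 1)}.ncard : ℝ) ∧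
    ({y : Pt m | b i ≤ wt y ∧ wt y < b (i + 1)}.ncard : ℝ) ≤
        (1 + ℓ / Real.sqrt m) * 2 ^ m / ℓ

/-- `BB` is the balanced-blocks function associated to the partition `b`:
it is `true` exactly on the blocks `B_i` with `i` odd (1-indexed), i.e. those whose
0-indexed position is even. -/
def IsBBFun (m ℓ : ℕ) (b : ℕ → ℕ) (BB : Pt m → Bool) : Prop :=
  ∀ y : Pt m, BB y = true ↔ ∃ i < ℓ, Even i ∧ b i ≤ wt y ∧ wt y < b (i + 1)

/-- The weight `w` belongs to `MID_L`, i.e. `|w - n_L/2| ≤ √n_L/100`. -/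
def midL (nL w : ℕ) : Prop := |(w : ℝ) - nL / 2| ≤ Real.sqrt nL / 100

/-- The weight of `z` restricted to the first `nL` coordinates (the set `L`). -/
def wL {n : ℕ} (nL : ℕ) (z : Pt n) : ℕ :=
  (Finset.univ.filter (fun i : Fin n => (i : ℕ) < nL ∧ z i = true)).card

/-- The weight of `z` restricted to the coordinates of index `≥ nL` (the set `R`). -/
def wR {n : ℕ} (nL : ℕ) (z : Pt n) : ℕ :=
  (Finset.univ.filter (fun i : Fin n => nL ≤ (i : ℕ) ∧ z i = true)).card

/-- The restriction of `z : Pt n` to the last `nR` coordinates, given `nL + nR = n`. -/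
def yPart {n : ℕ} (nL nR : ℕ) (h : nL + nR = n) (z : Pt n) : Pt nR :=
  fun j => z ⟨nL + (j : ℕ), by have hj := j.isLt; omega⟩

/-- `f` is the hard function built from `BB : Pt nR → Bool`: writing `z = (x,y)` with
`x` the first `nL` coordinates and `y` the last `nR` coordinates, `f z = BB y` when
`|x| ∈ MID_L`, and `f z = false` otherwise. -/
def IsHardFun {n : ℕ} (nL nR : ℕ) (h : nL + nR = n) (BB : Pt nR → Bool)
    (f : Pt n → Bool) : Prop :=
  ∀ z : Pt n,
    (midL nL (wL nL z) → f z = BB (yPart nL nR h z)) ∧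
    (¬ midL nL (wL nL z) → f z = false)

/-- The maximal chain generated by a permutation `σ`: `z_i(j) = decide (σ⁻¹ j < i)`. -/
def chainOf {n : ℕ} (σ : Equiv.Perm (Fin n)) : ℕ → Pt n :=
  fun i j => decide ((σ.symm j : ℕ) < i)

/-- `Z 0 ≺ Z 1 ≺ ⋯ ≺ Z n` is a maximal chain in `{0,1}^n`
(so `Z 0 = 0ⁿ`, `Z n = 1ⁿ` and `|Z i| = i`). -/
def IsFullChain {n : ℕ} (Z : ℕ → Pt n) : Prop :=
  (∀ i < n, plt (Z i) (Z (i + 1))) ∧ ∀ i ≤ n, wt (Z i) = i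

/-- The chain `Z 0 ≺ ⋯ ≺ Z n` contains a violation of `k`-monotonicity of `f`:
some `k+1` of its points form such a violation. -/
def ChainViol {n : ℕ} (k : ℕ) (f : Pt n → Bool) (Z : ℕ → Pt n) : Prop :=
  ∃ t : ℕ → ℕ, (∀ i < k, t i < t (i + 1)) ∧ (∀ i ≤ k, t i ≤ n) ∧
    f (Z (t 0)) = true ∧ ∀ i < k, f (Z (t i)) ≠ f (Z (t (i + 1)))

/-- The probability, over a uniformly random permutation `σ` of `Fin n`
(equivalently, a uniformly random maximal chain `chainOf σ`), of the event `P`. -/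
noncomputable def permProb (n : ℕ) (P : Equiv.Perm (Fin n) → Prop) : ℝ :=
  ({σ : Equiv.Perm (Fin n) | P σ}.ncard : ℝ) / Nat.factorial n

/-- The set `V(Z)`: all `j` such that some point `z = (x,y)` on the chain `Z`
has `|x| ∈ MID_L` and `|y| = j`. -/
def VSet {n : ℕ} (nL : ℕ) (Z : ℕ → Pt n) : Set ℕ :=
  {j | ∃ i ≤ n, midL nL (wL nL (Z i)) ∧ wR nL (Z i) = j}

theorem two_mul_add_one_mul_centralBinom_sq_le (n : ℕ) :
    (2 * n + 1) * n.centralBinom ^ 2 ≤ 16 ^ n := by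
  induction n with
  | zero => simp
  | succ n ih =>
    have h := Nat.succ_mul_centralBinom_succ n
    have h2 : (n + 1) ^ 2 * (n + 1).centralBinom ^ 2
        = 4 * (2 * n + 1) ^ 2 * n.centralBinom ^ 2 := by
      rw [← mul_pow, h]; ring
    refine le_of_mul_le_mul_left (a := (n + 1) ^ 2) ?_ (by positivity)
    calc (n + 1) ^ 2 * ((2 * (n + 1) + 1) * (n + 1).centralBinom ^ 2)
        = (2 * n + 3) * ((n + 1) ^ 2 * (n + 1).centralBinom ^ 2) := by ring
      _ = 4 * ((2 * n + 3) * (2 * n + 1)) * ((2 * n + 1) * n.centralBinom ^ 2) := by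
          rw [h2]; ring
      _ ≤ (16 * (n + 1) ^ 2) * 16 ^ n := Nat.mul_le_mul (by nlinarith) ih
      _ = (n + 1) ^ 2 * 16 ^ (n + 1) := by ring

theorem le_four_mul_mul_centralBinom_sq {n : ℕ} (hn : 1 ≤ n) :
    16 ^ n ≤ 4 * n * n.centralBinom ^ 2 := by
  induction n, hn using Nat.le_induction with
  | base => norm_num [Nat.centralBinom, Nat.choose]
  | succ n hn ih =>
    have h := Nat.succ_mul_centralBinom_succ n
    have h2 : (n + 1) ^ 2 * (n + 1).centralBinom ^ 2
        = 4 * (2 * n + 1) ^ 2 * n.centralBinom ^ 2 := by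
      rw [← mul_pow, h]; ring
    refine le_of_mul_le_mul_left (a := n + 1) ?_ (by positivity)
    calc (n + 1) * 16 ^ (n + 1) = 16 * (n + 1) * 16 ^ n := by ring
      _ ≤ 16 * (n + 1) * (4 * n * n.centralBinom ^ 2) := Nat.mul_le_mul_left _ ih
      _ = 16 * (4 * n * (n + 1)) * n.centralBinom ^ 2 := by ring
      _ ≤ 16 * (2 * n + 1) ^ 2 * n.centralBinom ^ 2 := by
          gcongr; nlinarith
      _ = 4 * ((n + 1) ^ 2 * (n + 1).centralBinom ^ 2) := by rw [h2]; ring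
      _ = (n + 1) * (4 * (n + 1) * (n + 1).centralBinom ^ 2) := by ring

theorem choose_sq_mul_le (m j : ℕ) : m.choose j ^ 2 * m ≤ 4 ^ m := by
  obtain ⟨n, rfl | rfl⟩ := Nat.even_or_odd' m
  · calc (2 * n).choose j ^ 2 * (2 * n)
        ≤ n.centralBinom ^ 2 * (2 * n + 1) := by
          gcongr
          · exact Nat.choose_le_centralBinom j n
          · omega
      _ ≤ 16 ^ n := by rw [mul_comm]; exact two_mul_add_one_mul_centralBinom_sq_le n
      _ = 4 ^ (2 * n) := by rw [pow_mul]; norm_num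
  · have h1 : (2 * n + 1).choose j ≤ (2 * n + 1).choose n := by
      have := Nat.choose_le_middle j (2 * n + 1)
      rwa [show (2 * n + 1) / 2 = n by omega] at this
    have h2 : (n + 1).centralBinom = 2 * (2 * n + 1).choose n := by
      rw [Nat.centralBinom, show 2 * (n + 1) = (2 * n + 1) + 1 by ring,
        Nat.choose_succ_succ, Nat.choose_symm_half]; ring
    have h3 := two_mul_add_one_mul_centralBinom_sq_le (n + 1)
    rw [h2] at h3
    refine le_of_mul_le_mul_left (a := 4) ?_ (by norm_num)
    calc 4 * ((2 * n + 1).choose j ^ 2 * (2 * n + 1))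
        ≤ 4 * ((2 * n + 1).choose n ^ 2 * (2 * (n + 1) + 1)) := by
          gcongr; omega
      _ = (2 * (n + 1) + 1) * (2 * (2 * n + 1).choose n) ^ 2 := by ring
      _ ≤ 16 ^ (n + 1) := h3
      _ = 4 * 4 ^ (2 * n + 1) := by
          rw [show (16 : ℕ) = 4 ^ 2 by norm_num, ← pow_mul]; ring

theorem choose_mul_sqrt_le (m j : ℕ) : (m.choose j : ℝ) * Real.sqrt m ≤ 2 ^ m := by
  have h : ((m.choose j : ℝ)) ^ 2 * m ≤ 4 ^ m := by exact_mod_cast choose_sq_mul_le m j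
  refine (sq_le_sq₀ (by positivity) (by positivity)).1 ?_
  rw [mul_pow, Real.sq_sqrt (by positivity), ← pow_mul, mul_comm m 2, pow_mul]
  norm_num
  exact h

theorem choose_add_ge (h t : ℕ) (ht : t ≤ h) :
    (1 - (t : ℝ) ^ 2 / h) * h.centralBinom ≤ ((2 * h).choose (h + t) : ℝ) := by
  induction t with
  | zero => simp [Nat.centralBinom]
  | succ t ih =>
    have ih := ih (by omega)
    have hh : (0 : ℝ) < h := by exact_mod_cast (by omega : 0 < h)
    have ht' : (t : ℝ) + 1 ≤ h := by exact_mod_cast ht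
    rcases le_or_gt (1 - ((t + 1 : ℕ) : ℝ) ^ 2 / h) 0 with h0 | h0
    · exact (mul_nonpos_of_nonpos_of_nonneg h0 (by positivity)).trans (by positivity)
    have hs := Nat.choose_succ_right_eq (2 * h) (h + t)
    have hs' : ((2 * h).choose (h + t + 1) : ℝ) * (h + t + 1)
        = (2 * h).choose (h + t) * (h - t) := by
      have : 2 * h - (h + t) = h - t := by omega
      rw [this] at hs
      have := congrArg (Nat.cast (R := ℝ)) hs
      push_cast [Nat.cast_sub (by omega : t ≤ h)] at this
      exact this
    have hpos : (0 : ℝ) < h + t + 1 := by positivity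
    rw [← add_assoc]
    have hC : ((2 * h).choose (h + t + 1) : ℝ)
        = (2 * h).choose (h + t) * ((h - t) / (h + t + 1)) := by
      field_simp; linarith
    rw [hC]
    calc (1 - ((t + 1 : ℕ) : ℝ) ^ 2 / h) * h.centralBinom
        ≤ ((1 - (t : ℝ) ^ 2 / h) * ((h - t) / (h + t + 1))) * h.centralBinom := by
          gcongr
          have e1 : ((h : ℝ) - t) / (h + t + 1) = 1 - (2 * t + 1) / (h + t + 1) := by
            field_simp; ring
          have e2 : (2 * (t : ℝ) + 1) / (h + t + 1) ≤ (2 * t + 1) / h := by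
            gcongr; linarith
          have e3 : 0 ≤ (t : ℝ) ^ 2 / h * ((2 * t + 1) / (h + t + 1)) := by positivity
          have e4 : ((t + 1 : ℕ) : ℝ) ^ 2 / h = (t : ℝ) ^ 2 / h + (2 * t + 1) / h := by
            push_cast; field_simp; ring
          rw [e1, e4]
          nlinarith
      _ = ((1 - (t : ℝ) ^ 2 / h) * h.centralBinom) * ((h - t) / (h + t + 1)) := by ring
      _ ≤ _ := by
          gcongr
          apply div_nonneg <;> linarith

theorem centralBinom_mul_sqrt_ge {h : ℕ} (hh : 1 ≤ h) :
    (4 : ℝ) ^ h ≤ 2 * Real.sqrt h * h.centralBinom := by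
  refine (sq_le_sq₀ (by positivity) (by positivity)).1 ?_
  rw [mul_pow, mul_pow, Real.sq_sqrt (by positivity), ← pow_mul, mul_comm h 2, pow_mul]
  norm_num
  exact_mod_cast le_four_mul_mul_centralBinom_sq hh

open Finset in
/-- The number of `true` positions of the word `u` that are preceded by at least `a` and fewer than
`b` positions carrying `false`. -/
def trueBetween {n : ℕ} (u : Fin n → Bool) (a b : ℕ) : ℕ :=
  #{t | u t = true ∧ a ≤ #{s | s < t ∧ u s = false} ∧ #{s | s < t ∧ u s = false} < b}

theorem trueBetween_zero_right {n : ℕ} (u : Fin n → Bool) (a : ℕ) : trueBetween u a 0 = 0 := by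
  simp [trueBetween]

open Finset in
theorem trueBetween_of_zero_false {n : ℕ} (u : Fin (n + 1) → Bool) (a b : ℕ) (h : u 0 = false) :
    trueBetween u a (b + 1) = trueBetween (fun i => u i.succ) (a - 1) b := by
  have hc (t : Fin n) : #{s : Fin (n + 1) | s < t.succ ∧ u s = false}
      = #{s : Fin n | s < t ∧ u s.succ = false} + 1 := by
    rw [Fin.card_filter_univ_succ]; simp [h]
  unfold trueBetween
  rw [Fin.card_filter_univ_succ]
  simp only [h, hc]
  simp

open Finset in
theorem trueBetween_of_zero_true {n : ℕ} (u : Fin (n + 1) → Bool) (a b : ℕ) (h : u 0 = true) :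
    trueBetween u a (b + 1) =
      (if a = 0 then 1 else 0) + trueBetween (fun i => u i.succ) a (b + 1) := by
  have hc (t : Fin n) : #{s : Fin (n + 1) | s < t.succ ∧ u s = false}
      = #{s : Fin n | s < t ∧ u s.succ = false} := by
    rw [Fin.card_filter_univ_succ]; simp [h]
  unfold trueBetween
  rw [Fin.card_filter_univ_succ']
  simp only [h, hc]
  simp

open Finset in
theorem card_filter_swap_succ {n : ℕ} (c : Fin (n + 1) → Bool) (p : Fin (n + 1)) (β : Bool) :
    #{j | c j = β} =
      (if c p = β then 1 else 0) + #{i : Fin n | c (Equiv.swap 0 p i.succ) = β} := by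
  have h : #{j | c j = β} = #{j | c (Equiv.swap 0 p j) = β} := by
    refine (Finset.card_equiv (Equiv.swap 0 p) ?_).symm
    simp
  rw [h, Fin.card_filter_univ_succ']
  simp

open Finset in
/-- In a uniformly random arrangement of a word in which the `true` letters are rare, the
exponential moment of the number of `true` letters seen while the number of `false` letters
goes from `a` to `b` grows at most geometrically in `b - a`. -/
theorem sum_two_pow_trueBetween_le {ρ κ : ℝ} (hρ : 0 ≤ ρ) (hκ : 1 ≤ κ) (hρκ : 1 ≤ κ * (1 - ρ)) :
    ∀ (n : ℕ) (c : Fin n → Bool) (a b : ℕ),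
      (#{j | c j = true} : ℝ) + ρ * b ≤ ρ * #{j | c j = false} →
      ∑ τ : Equiv.Perm (Fin n), (2 : ℝ) ^ trueBetween (fun t => c (τ t)) a b
        ≤ n.factorial * κ ^ (b - a) := by
  intro n
  induction n with
  | zero =>
    intro c a b _
    simpa [trueBetween] using one_le_pow₀ hκ
  | succ n ih =>
    intro c a b hc
    obtain _ | b := b
    · simp [trueBetween_zero_right, Fintype.card_perm]
    set A : ℝ := (if a = 0 then 2 else 1) * (n.factorial * κ ^ (b + 1 - a)) with hA
    set B : ℝ := n.factorial * κ ^ (b - (a - 1)) with hB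
    have key (p : Fin (n + 1)) :
        ∑ e : Equiv.Perm (Fin n),
          (2 : ℝ) ^ trueBetween (fun t => c (Equiv.Perm.decomposeFin.symm (p, e) t)) a (b + 1)
        ≤ if c p = true then A else B := by
      have ht := card_filter_swap_succ c p true
      have hf := card_filter_swap_succ c p false
      cases hp : c p
      · rw [hp] at ht hf
        have h1 := ih (fun i => c (Equiv.swap 0 p i.succ)) (a - 1) b (by
          rw [ht, hf] at hc
          push_cast at hc
          norm_num at hc
          linarith)
        simp only [Bool.false_eq_true, if_false]
        refine le_trans (le_of_eq ?_) h1
        refine Finset.sum_congr rfl fun e _ => ?_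
        rw [trueBetween_of_zero_false _ _ _ (by simp [hp])]
        simp
      · rw [hp] at ht hf
        have h1 := ih (fun i => c (Equiv.swap 0 p i.succ)) a (b + 1) (by
          rw [ht, hf] at hc
          push_cast at hc ⊢
          norm_num at hc
          linarith)
        simp only [if_true]
        rw [hA]
        refine le_trans (le_of_eq ?_) (mul_le_mul_of_nonneg_left h1 (by split_ifs <;> norm_num))
        rw [Finset.mul_sum]
        refine Finset.sum_congr rfl fun e _ => ?_
        rw [trueBetween_of_zero_true _ _ _ (by simp [hp]), pow_add]
        congr 1
        · split_ifs <;> norm_num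
        · simp
    rw [← Equiv.Perm.decomposeFin.symm.sum_comp, Fintype.sum_prod_type]
    refine (Finset.sum_le_sum fun p _ => key p).trans ?_
    rw [Finset.sum_ite]
    simp only [Finset.sum_const, nsmul_eq_mul, Bool.not_eq_true]
    have hcard : (#{j | c j = true} : ℝ) + #{j | c j = false} = n + 1 := by
      have := Finset.card_filter_add_card_filter_not (s := (univ : Finset (Fin (n + 1))))
        (fun j => c j = true)
      simp only [Bool.not_eq_true, card_univ, Fintype.card_fin] at this
      exact_mod_cast this
    set m : ℝ := (#{j | c j = true} : ℝ)
    set l : ℝ := (#{j | c j = false} : ℝ)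
    have hl : 0 ≤ l := by positivity
    have hm : 0 ≤ m := by positivity
    rw [Nat.factorial_succ]
    push_cast
    rw [← hcard]
    obtain _ | a := a
    · have h1 : m ≤ ρ * l := by
        have : 0 ≤ ρ * ((b + 1 : ℕ) : ℝ) := by positivity
        linarith
      have h2 : l + m * κ ≤ l * κ := by nlinarith
      rw [hA, hB]
      simp only [if_true, Nat.sub_zero, Nat.zero_sub]
      have h3 : 0 ≤ (n.factorial : ℝ) * κ ^ b := by positivity
      rw [pow_succ]
      nlinarith [mul_le_mul_of_nonneg_left h2 h3]
    · rw [hA, hB]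
      simp only [Nat.add_sub_cancel, Nat.add_sub_add_right]
      simp
      apply le_of_eq
      ring

open Finset in
theorem card_le_trueBetween_le {ρ κ : ℝ} (hρ : 0 ≤ ρ) (hκ : 1 ≤ κ) (hρκ : 1 ≤ κ * (1 - ρ))
    {n : ℕ} (c : Fin n → Bool) (a b : ℕ)
    (hc : (#{j | c j = true} : ℝ) + ρ * b ≤ ρ * #{j | c j = false}) (q : ℕ) :
    (#{τ : Equiv.Perm (Fin n) | q ≤ trueBetween (fun t => c (τ t)) a b} : ℝ) * 2 ^ q
      ≤ n.factorial * κ ^ (b - a) := by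
  refine le_trans ?_ (sum_two_pow_trueBetween_le hρ hκ hρκ n c a b hc)
  rw [← nsmul_eq_mul, ← Finset.sum_const]
  refine (Finset.sum_le_sum fun τ hτ => ?_).trans
    (Finset.sum_le_sum_of_subset_of_nonneg (Finset.filter_subset _ _) fun _ _ _ => by positivity)
  exact pow_le_pow_right₀ (by norm_num) (Finset.mem_filter.1 hτ).2

open Finset in
theorem card_filter_wt_eq (m l : ℕ) : #{y : Pt m | wt y = l} = m.choose l := by
  have hc : #(Finset.powersetCard l (univ : Finset (Fin m))) = m.choose l := by simp
  rw [← hc]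
  refine Finset.card_nbij' (fun y => ({i | y i = true} : Finset (Fin m)))
    (fun S i => decide (i ∈ S)) ?_ ?_ ?_ ?_
  · intro y hy
    exact Finset.mem_powersetCard_univ.2 (Finset.mem_filter.1 hy).2
  · intro S hS
    refine Finset.mem_filter.2 ⟨Finset.mem_univ _, ?_⟩
    simpa [wt] using Finset.mem_powersetCard_univ.1 hS
  · intro y _
    simp
  · intro S _
    simp

open Finset in
theorem ncard_wt_mem_Ico (m lo hi : ℕ) :
    {y : Pt m | lo ≤ wt y ∧ wt y < hi}.ncard = ∑ l ∈ Finset.Ico lo hi, m.choose l := by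
  have h : {y : Pt m | lo ≤ wt y ∧ wt y < hi}
      = (({y : Pt m | wt y ∈ Finset.Ico lo hi} : Finset (Pt m)) : Set (Pt m)) := by
    ext y; simp
  rw [h, Set.ncard_coe_finset,
    Finset.card_eq_sum_card_fiberwise (f := wt) (t := Finset.Ico lo hi)
      (fun y hy => by simpa using hy)]
  refine Finset.sum_congr rfl fun l hl => ?_
  rw [← card_filter_wt_eq, Finset.filter_filter]
  congr 1
  ext y
  simp only [Finset.mem_filter, Finset.mem_univ, true_and]
  exact ⟨fun h => h.2, fun h => ⟨h ▸ hl, h⟩⟩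

theorem wt_le {m : ℕ} (y : Pt m) : wt y ≤ m := by
  simpa [wt] using Finset.card_filter_le (Finset.univ : Finset (Fin m)) (fun i => y i = true)

namespace IsBBPartition

variable {m ℓ : ℕ} {b : ℕ → ℕ}

theorem mono (hb : IsBBPartition m ℓ b) {i j : ℕ} (hij : i ≤ j) (hj : j ≤ ℓ) : b i ≤ b j := by
  induction j, hij using Nat.le_induction with
  | base => rfl
  | succ j _ ih => exact (ih (by omega)).trans (hb.2.2.1 j (by omega)).le

theorem exists_mem (hb : IsBBPartition m ℓ b) {w : ℕ} (hw : w ≤ m) :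
    ∃ i < ℓ, b i ≤ w ∧ w < b (i + 1) := by
  have key : ∀ j ≤ ℓ, w < b j → ∃ i < ℓ, b i ≤ w ∧ w < b (i + 1) := by
    intro j
    induction j with
    | zero => intro _ h; rw [hb.1] at h; omega
    | succ j ih =>
      intro hj h
      by_cases h' : w < b j
      · exact ih (by omega) h'
      · exact ⟨j, by omega, by omega, h⟩
  exact key ℓ le_rfl (by rw [hb.2.1]; omega)

theorem le_of_mem (hb : IsBBPartition m ℓ b) {i j w w' : ℕ} (hi : i < ℓ)
    (hiw : b i ≤ w) (hjw : w' < b (j + 1)) (hw : w ≤ w') : i ≤ j := by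
  by_contra! h
  have := hb.mono (Nat.succ_le_of_lt h) hi.le
  rw [Nat.succ_eq_add_one] at this
  omega

theorem apply_eq (hb : IsBBPartition m ℓ b) {BB : Pt m → Bool} (hBB : IsBBFun m ℓ b BB)
    {y : Pt m} {i : ℕ} (hi : i < ℓ) (h1 : b i ≤ wt y) (h2 : wt y < b (i + 1)) :
    BB y = decide (Even i) := by
  rw [Bool.eq_iff_iff, hBB y, decide_eq_true_iff]
  constructor
  · rintro ⟨j, hj, hje, h3, h4⟩
    have := hb.le_of_mem hi h1 h4 le_rfl
    have := hb.le_of_mem hj h3 h2 le_rfl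
    rwa [show i = j by omega]
  · exact fun h => ⟨i, hi, h, h1, h2⟩

theorem block_ge {s : ℕ} (hs : 0 < s) (hm : 6 * (s : ℝ) ≤ Real.sqrt m)
    (hb : IsBBPartition m (3 * s) b) {i : ℕ} (hi : i < 3 * s) :
    (2 : ℝ) ^ m / (6 * s) ≤ ∑ l ∈ Finset.Ico (b i) (b (i + 1)), (m.choose l : ℝ) := by
  have h := (hb.2.2.2 i hi).1
  rw [ncard_wt_mem_Ico] at h
  push_cast at h
  refine le_trans ?_ h
  have hs' : (0 : ℝ) < s := by exact_mod_cast hs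
  have hsq : 0 < Real.sqrt m := by linarith
  have h1 : 3 * (s : ℝ) / Real.sqrt m ≤ 1 / 2 := by
    rw [div_le_iff₀ hsq]; linarith
  have h2 : (2 : ℝ) ^ m / (6 * s) = (1 / 2) * 2 ^ m / (3 * s) := by
    field_simp; norm_num
  rw [h2]
  gcongr
  linarith

theorem width_ge {s : ℕ} (hs : 0 < s) (hm : 6 * (s : ℝ) ≤ Real.sqrt m)
    (hb : IsBBPartition m (3 * s) b) {i : ℕ} (hi : i < 3 * s) :
    Real.sqrt m / (6 * s) ≤ (b (i + 1) : ℝ) - b i := by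
  have h := hb.block_ge hs hm hi
  have hs' : (0 : ℝ) < s := by exact_mod_cast hs
  have hsq : 0 < Real.sqrt m := by linarith
  have h1 : ∑ l ∈ Finset.Ico (b i) (b (i + 1)), (m.choose l : ℝ)
      ≤ ∑ l ∈ Finset.Ico (b i) (b (i + 1)), 2 ^ m / Real.sqrt m :=
    Finset.sum_le_sum fun l _ => (le_div_iff₀ hsq).2 (choose_mul_sqrt_le m l)
  rw [Finset.sum_const, Nat.card_Ico, nsmul_eq_mul, Nat.cast_sub (hb.2.2.1 i hi).le] at h1
  have h2 := h.trans h1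
  rw [div_le_iff₀ (by positivity)] at h2 ⊢
  have h3 : (0 : ℝ) < 2 ^ m := by positivity
  refine le_of_mul_le_mul_left ?_ h3
  calc (2 : ℝ) ^ m * Real.sqrt m
      ≤ (((b (i + 1) : ℝ) - b i) * (2 ^ m / Real.sqrt m) * (6 * s)) * Real.sqrt m := by gcongr
    _ = _ := by field_simp

theorem mul_width_le {s : ℕ} (hs : 0 < s) (hm : 6 * (s : ℝ) ≤ Real.sqrt m)
    (hb : IsBBPartition m (3 * s) b) {i d : ℕ} (hi : i + d ≤ 3 * s) :
    d * (Real.sqrt m / (6 * s)) ≤ (b (i + d) : ℝ) - b i := by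
  induction d with
  | zero => simp
  | succ d ih =>
    have h1 := ih (by omega)
    have h2 := hb.width_ge hs hm (i := i + d) (by omega)
    push_cast
    rw [← add_assoc]
    linarith

/-- If the balanced-blocks function alternates `k` times along points of nondecreasing weight, then
the weight grows by at least `k - 1` block widths. -/
theorem weight_gap {s k : ℕ} (hk : 1 ≤ k) (hs : 0 < s) (hm : 6 * (s : ℝ) ≤ Real.sqrt m)
    (hb : IsBBPartition m (3 * s) b) {BB : Pt m → Bool} (hBB : IsBBFun m (3 * s) b BB)
    (y : ℕ → Pt m) (hy : ∀ i < k, wt (y i) ≤ wt (y (i + 1)))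
    (halt : ∀ i < k, BB (y i) ≠ BB (y (i + 1))) :
    ((k : ℝ) - 1) * (Real.sqrt m / (6 * s)) ≤ (wt (y k) : ℝ) - wt (y 0) := by
  choose β hβ hβ1 hβ2 using fun i => hb.exists_mem (wt_le (y i))
  have hstep : ∀ i < k, β i < β (i + 1) := by
    intro i hi
    refine lt_of_le_of_ne (hb.le_of_mem (hβ i) (hβ1 i) (hβ2 (i + 1)) (hy i hi)) fun h => ?_
    refine halt i hi ?_
    rw [hb.apply_eq hBB (hβ i) (hβ1 i) (hβ2 i),
      hb.apply_eq hBB (hβ (i + 1)) (hβ1 (i + 1)) (hβ2 (i + 1)), h]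
  have hge : ∀ i ≤ k, β 0 + i ≤ β i := by
    intro i
    induction i with
    | zero => simp
    | succ i ih =>
      intro hi
      have := ih (by omega)
      have := hstep i (by omega)
      omega
  have h1 := hge k le_rfl
  have h2 := hβ k
  have h3 := hb.mono h1 h2.le
  have h4 := hb.mul_width_le hs hm (i := β 0 + 1) (d := k - 1) (by omega)
  rw [show β 0 + 1 + (k - 1) = β 0 + k by omega, Nat.cast_sub hk, Nat.cast_one] at h4
  have h5 : (b (β 0 + k) : ℝ) ≤ wt (y k) := by exact_mod_cast h3.trans (hβ1 k)
  have h6 : (wt (y 0) : ℝ) ≤ b (β 0 + 1) := by exact_mod_cast (hβ2 0).le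
  linarith

end IsBBPartition

theorem wt_yPart {n nL nR : ℕ} (h : nL + nR = n) (z : Pt n) :
    wt (yPart nL nR h z) = wR nL z := by
  subst h
  unfold wt wR yPart
  refine Finset.card_nbij (fun j => ⟨nL + (j : ℕ), by omega⟩) ?_ ?_ ?_
  · intro j hj
    simpa using hj
  · intro i _ j _ hij
    simpa [Fin.ext_iff] using hij
  · intro i hi
    simp only [Finset.coe_filter, Finset.mem_univ, true_and, Set.mem_ofPred_eq] at hi
    refine ⟨⟨i - nL, by omega⟩, ?_, ?_⟩
    · simp only [Finset.coe_filter, Finset.mem_univ, true_and, Set.mem_ofPred_eq]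
      rw [← hi.2]
      congr 1
      simp only [Fin.ext_iff]
      omega
    · simp only [Fin.ext_iff]
      omega

open Finset in
theorem wR_chainOf {n : ℕ} (nL : ℕ) (σ τ : Equiv.Perm (Fin n)) (i : ℕ) :
    wR nL (fun j => chainOf τ i (σ j)) =
      #{t : Fin n | (t : ℕ) < i ∧ decide (nL ≤ (σ.symm (τ t) : ℕ)) = true} := by
  unfold wR chainOf
  refine Finset.card_equiv (σ.trans τ.symm) fun j => ?_
  simp [and_comm]

open Finset in
theorem wL_chainOf {n : ℕ} (nL : ℕ) (σ τ : Equiv.Perm (Fin n)) (i : ℕ) :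
    wL nL (fun j => chainOf τ i (σ j)) =
      #{t : Fin n | (t : ℕ) < i ∧ decide (nL ≤ (σ.symm (τ t) : ℕ)) = false} := by
  unfold wL chainOf
  refine Finset.card_equiv (σ.trans τ.symm) fun j => ?_
  simp [and_comm]

open Finset in
theorem card_true_le_add_trueBetween {n : ℕ} (u : Fin n → Bool) {a b i j : ℕ}
    (ha : a ≤ #{t : Fin n | (t : ℕ) < i ∧ u t = false})
    (hb : #{t : Fin n | (t : ℕ) < j ∧ u t = false} < b) :
    #{t : Fin n | (t : ℕ) < j ∧ u t = true} ≤
      #{t : Fin n | (t : ℕ) < i ∧ u t = true} + trueBetween u a b := by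
  refine le_trans (Finset.card_le_card ?_) (Finset.card_union_le _ _)
  intro t ht
  simp only [Finset.mem_filter, Finset.mem_univ, true_and, Finset.mem_union] at ht ⊢
  by_cases hti : (t : ℕ) < i
  · exact Or.inl ⟨hti, ht.2⟩
  refine Or.inr ⟨ht.2, ha.trans (Finset.card_le_card ?_), (Finset.card_le_card ?_).trans_lt hb⟩
  · intro r hr
    simp only [Finset.mem_filter, Finset.mem_univ, true_and, Fin.lt_def] at hr ⊢
    exact ⟨by omega, hr.2⟩
  · intro r hr
    simp only [Finset.mem_filter, Finset.mem_univ, true_and, Fin.lt_def] at hr ⊢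
    exact ⟨by omega, hr.2⟩

theorem midL_of_le {nL w₁ w w₂ : ℕ} (h₁ : midL nL w₁) (h₂ : midL nL w₂) (h : w₁ ≤ w)
    (h' : w ≤ w₂) : midL nL w := by
  have e1 : (w₁ : ℝ) ≤ w := by exact_mod_cast h
  have e2 : (w : ℝ) ≤ w₂ := by exact_mod_cast h'
  unfold midL at *
  rw [abs_le] at *
  constructor <;> linarith

theorem monotone_chainOf {n : ℕ} (τ : Equiv.Perm (Fin n)) {i i' : ℕ} (h : i ≤ i') (j : Fin n) :
    chainOf τ i j = true → chainOf τ i' j = true := by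
  simp only [chainOf, decide_eq_true_eq]
  omega

theorem le_trueBetween_of_chainViol {k s n nR nL : ℕ} (hk : 2 ≤ k) (hke : Even k) (hs : 0 < s)
    (hsum : nL + nR = n) (hm : 6 * (s : ℝ) ≤ Real.sqrt nR) {b : ℕ → ℕ} {BB : Pt nR → Bool}
    (hb : IsBBPartition nR (3 * s) b) (hBB : IsBBFun nR (3 * s) b BB) {f : Pt n → Bool}
    (hf : IsHardFun nL nR hsum BB f) (σ τ : Equiv.Perm (Fin n)) {a c : ℕ}
    (hac : ∀ w, midL nL w → a ≤ w ∧ w < c)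
    (hv : ChainViol k (fun z => f (fun i => z (σ i))) (chainOf τ)) :
    ((k : ℝ) - 1) * (Real.sqrt nR / (6 * s)) ≤
      trueBetween (fun t => decide (nL ≤ (σ.symm (τ t) : ℕ))) a c := by
  obtain ⟨t, ht, -, h0, halt⟩ := hv
  have hmono : ∀ i j, i ≤ j → j ≤ k → t i ≤ t j := by
    intro i j hij
    induction j, hij using Nat.le_induction with
    | base => exact fun _ => le_rfl
    | succ j _ ih => exact fun hj => (ih (by omega)).trans (ht j (by omega)).le
  set Z : ℕ → Pt n := fun i j => chainOf τ (t i) (σ j) with hZ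
  have hval : ∀ i ≤ k, f (Z i) = decide (Even i) := by
    intro i
    induction i with
    | zero => intro _; simpa using h0
    | succ i ih =>
      intro hi
      have h1 := halt i (by omega)
      have h2 := ih (by omega)
      change f (Z i) ≠ f (Z (i + 1)) at h1
      rw [h2] at h1
      simp only [Nat.even_add_one, decide_not]
      revert h1
      cases decide (Even i) <;> cases f (Z (i + 1)) <;> simp
  have hmid : ∀ i, f (Z i) = true → midL nL (wL nL (Z i)) := by
    intro i hi
    by_contra h
    rw [(hf (Z i)).2 h] at hi
    exact Bool.false_ne_true hi
  have hwL : ∀ i j, i ≤ j → j ≤ k → wL nL (Z i) ≤ wL nL (Z j) := fun i j hij hj =>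
    Finset.card_le_card fun r hr => by
      simp only [Finset.mem_filter, Finset.mem_univ, true_and] at hr ⊢
      exact ⟨hr.1, monotone_chainOf τ (hmono i j hij hj) _ hr.2⟩
  have hwR : ∀ i j, i ≤ j → j ≤ k → wR nL (Z i) ≤ wR nL (Z j) := fun i j hij hj =>
    Finset.card_le_card fun r hr => by
      simp only [Finset.mem_filter, Finset.mem_univ, true_and] at hr ⊢
      exact ⟨hr.1, monotone_chainOf τ (hmono i j hij hj) _ hr.2⟩
  have hm0 := hmid 0 (by rw [hval 0 (by omega)]; simp)
  have hmk := hmid k (by rw [hval k le_rfl]; simpa using hke)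
  have hBBv : ∀ i ≤ k, BB (yPart nL nR hsum (Z i)) = f (Z i) := fun i hi =>
    ((hf (Z i)).1 (midL_of_le hm0 hmk (hwL 0 i (by omega) hi) (hwL i k hi le_rfl))).symm
  have hgap := hb.weight_gap (by omega : 1 ≤ k) hs hm hBB (fun i => yPart nL nR hsum (Z i))
    (fun i hi => by simpa only [wt_yPart] using hwR i (i + 1) (by omega) (by omega))
    (fun i hi => by
      simp only [hBBv i hi.le, hBBv (i + 1) hi]
      exact halt i hi)
  simp only [wt_yPart] at hgap
  have h1 := (hac _ hm0).1
  have h2 := (hac _ hmk).2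
  rw [hZ] at h1 h2 hgap
  simp only [wL_chainOf, wR_chainOf] at h1 h2 hgap
  have h3 := card_true_le_add_trueBetween (fun t => decide (nL ≤ (σ.symm (τ t) : ℕ))) h1 h2
  have h4 : ((Finset.card {r : Fin n | (r : ℕ) < t k ∧ decide (nL ≤ (σ.symm (τ r) : ℕ)) = true}
      : ℕ) : ℝ) ≤ Finset.card {r : Fin n | (r : ℕ) < t 0 ∧
        decide (nL ≤ (σ.symm (τ r) : ℕ)) = true} +
      trueBetween (fun t => decide (nL ≤ (σ.symm (τ t) : ℕ))) a c := by
    exact_mod_cast h3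
  linarith

open Finset in
theorem card_color {n nL nR : ℕ} (hsum : nL + nR = n) (σ : Equiv.Perm (Fin n)) :
    #{j : Fin n | decide (nL ≤ (σ.symm j : ℕ)) = true} = nR ∧
    #{j : Fin n | decide (nL ≤ (σ.symm j : ℕ)) = false} = nL := by
  have h1 : #{j : Fin n | decide (nL ≤ (σ.symm j : ℕ)) = false} = #{j : Fin n | (j : ℕ) < nL} := by
    refine Finset.card_equiv σ.symm fun j => ?_
    simp
  have h2 := Finset.card_filter_add_card_filter_not (s := (univ : Finset (Fin n)))
    (fun j => decide (nL ≤ (σ.symm j : ℕ)) = true)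
  simp only [Bool.not_eq_true, card_univ, Fintype.card_fin] at h2
  rw [h1, Fin.card_filter_val_lt, min_eq_right (by omega)] at h2
  rw [h1, Fin.card_filter_val_lt, min_eq_right (by omega)]
  omega

set_option maxHeartbeats 1000000 in
theorem permProb_chainViol_le {k s n nR nL : ℕ} (hk : 2 ≤ k) (hke : Even k) (hks : k ≤ s)
    (hn : k ^ 2 * n = 625 * s ^ 2 * nR) (hsum : nL + nR = n)
    (hm : 100 * (s : ℝ) ≤ Real.sqrt nR) {b : ℕ → ℕ} {BB : Pt nR → Bool}
    (hb : IsBBPartition nR (3 * s) b) (hBB : IsBBFun nR (3 * s) b BB) {f : Pt n → Bool}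
    (hf : IsHardFun nL nR hsum BB f) (σ : Equiv.Perm (Fin n)) :
    permProb n (fun τ => ChainViol k (fun z => f (fun i => z (σ i))) (chainOf τ)) ≤
      Real.exp (-(1 / 1000) * ((k : ℝ) ^ 2 / (s : ℝ) ^ 2) * Real.sqrt n) := by
  have hk' : (2 : ℝ) ≤ k := by exact_mod_cast hk
  have hks' : (k : ℝ) ≤ s := by exact_mod_cast hks
  have hs0 : (0 : ℝ) < s := by linarith
  have hn' : (k : ℝ) ^ 2 * n = 625 * s ^ 2 * nR := by exact_mod_cast hn
  have hsum' : (nL : ℝ) + nR = n := by exact_mod_cast hsum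
  have hR0 : (0 : ℝ) ≤ nR := by positivity
  set x : ℝ := (k : ℝ) ^ 2 / (s : ℝ) ^ 2 with hx
  have hx0 : 0 < x := by positivity
  have hx1 : x ≤ 1 := by
    rw [hx, div_le_one (by positivity)]; gcongr
  have hnx : (nR : ℝ) = x * n / 625 := by
    rw [hx]; field_simp; linarith
  have hsqR : Real.sqrt nR = k / (25 * s) * Real.sqrt n := by
    have : (nR : ℝ) = (k / (25 * s)) ^ 2 * n := by rw [hnx, hx]; field_simp; norm_num
    rw [this, Real.sqrt_mul (by positivity), Real.sqrt_sq (by positivity)]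
  have hn1 : Real.sqrt nR ≤ Real.sqrt n / 25 := by
    rw [hsqR]
    have : (k : ℝ) / (25 * s) ≤ 1 / 25 := by
      rw [div_le_div_iff₀ (by positivity) (by norm_num)]; linarith
    nlinarith [Real.sqrt_nonneg (n : ℝ)]
  have hn2 : 5000 ≤ Real.sqrt n := by linarith
  have hLn : (nL : ℝ) ≤ n := by linarith
  have hsqL : Real.sqrt nL ≤ Real.sqrt n := Real.sqrt_le_sqrt hLn
  have hnn : Real.sqrt n * Real.sqrt n = n := Real.mul_self_sqrt (by positivity)
  have hn3 : 5000 * Real.sqrt n ≤ n := by nlinarith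
  have hL : 624 / 625 * (n : ℝ) ≤ nL := by nlinarith
  set a : ℕ := ⌈(nL : ℝ) / 2 - Real.sqrt nL / 100⌉₊ with ha
  set c : ℕ := ⌊(nL : ℝ) / 2 + Real.sqrt nL / 100⌋₊ + 1 with hc
  have hac : ∀ w, midL nL w → a ≤ w ∧ w < c := by
    intro w hw
    rw [midL, abs_le] at hw
    constructor
    · exact Nat.ceil_le.2 (by linarith)
    · exact Nat.lt_succ_of_le (Nat.le_floor (by linarith))
  have ha' : (nL : ℝ) / 2 - Real.sqrt nL / 100 ≤ a := Nat.le_ceil _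
  have hc' : (c : ℝ) ≤ nL / 2 + Real.sqrt nL / 100 + 1 := by
    rw [hc]; push_cast
    linarith [Nat.floor_le (a := (nL : ℝ) / 2 + Real.sqrt nL / 100) (by positivity)]
  have hca : ((c - a : ℕ) : ℝ) ≤ Real.sqrt n / 40 := by
    rcases le_total a c with h | h
    · rw [Nat.cast_sub h]; linarith
    · rw [Nat.sub_eq_zero_of_le h, Nat.cast_zero]; positivity
  have hc4 : (c : ℝ) ≤ 3 / 4 * nL := by linarith
  set ρ : ℝ := x / 156 with hρ
  have hρ0 : 0 < ρ := by positivity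
  have hρ1 : ρ ≤ 1 / 156 := by rw [hρ]; linarith
  have hκ : 1 ≤ Real.exp (2 * ρ) := Real.one_le_exp (by positivity)
  have hρκ : 1 ≤ Real.exp (2 * ρ) * (1 - ρ) := by
    nlinarith [Real.add_one_le_exp (2 * ρ)]
  set q : ℕ := ⌈((k : ℝ) - 1) * (Real.sqrt nR / (6 * s))⌉₊ with hq
  obtain ⟨hcR, hcL⟩ := card_color hsum σ
  have hmain := card_le_trueBetween_le hρ0.le hκ hρκ
    (fun j : Fin n => decide (nL ≤ (σ.symm j : ℕ))) a c (by
      rw [hcR, hcL]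
      have h1 : ρ * c ≤ ρ * (3 / 4 * nL) := by gcongr
      have h2 : ρ * (624 / 625 * (n : ℝ)) ≤ ρ * nL := by gcongr
      have h3 : (nR : ℝ) = ρ * (624 / 625 * (n : ℝ)) / 4 := by rw [hnx, hρ]; ring
      linarith) q
  have hsub : ({τ : Equiv.Perm (Fin n) |
      ChainViol k (fun z => f (fun i => z (σ i))) (chainOf τ)}.ncard : ℝ) ≤
      Finset.card {τ : Equiv.Perm (Fin n) |
        q ≤ trueBetween (fun t => decide (nL ≤ (σ.symm (τ t) : ℕ))) a c} := by
    rw [← Set.ncard_coe_finset]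
    refine Nat.cast_le.2 (Set.ncard_le_ncard ?_ (Set.toFinite _))
    intro τ hτ
    simp only [Finset.coe_filter, Finset.mem_univ, true_and, Set.mem_ofPred_eq]
    exact Nat.ceil_le.2
      (le_trueBetween_of_chainViol hk hke (by omega) hsum (by linarith) hb hBB hf σ τ hac hτ)
  have hfac : (0 : ℝ) < n.factorial := by positivity
  have hq' : x * Real.sqrt n / 300 ≤ q := by
    refine le_trans ?_ (Nat.le_ceil _)
    have h1 : (k : ℝ) / 2 ≤ k - 1 := by linarith
    calc x * Real.sqrt n / 300 = k / 2 * (Real.sqrt nR / (6 * s)) := by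
          rw [hsqR, hx]; field_simp; norm_num
      _ ≤ _ := by gcongr
  have h2q : Real.exp (x * Real.sqrt n / 500) ≤ 2 ^ q := by
    rw [← Real.exp_log (show (0 : ℝ) < 2 ^ q by positivity), Real.log_pow]
    refine Real.exp_le_exp.2 ?_
    have hlog : 3 / 5 ≤ Real.log 2 := by linarith [Real.log_two_gt_d9]
    have h3 := mul_le_mul_of_nonneg_left hlog (Nat.cast_nonneg (α := ℝ) q)
    linarith
  have hκw : Real.exp (2 * ρ) ^ (c - a) ≤ Real.exp (x * Real.sqrt n / 1000) := by
    rw [← Real.exp_nat_mul]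
    refine Real.exp_le_exp.2 ?_
    have h5 : ((c - a : ℕ) : ℝ) * (2 * ρ) ≤ Real.sqrt n / 40 * (2 * ρ) := by gcongr
    have h6 : 0 ≤ x * Real.sqrt n := by positivity
    have h7 : Real.sqrt n / 40 * (2 * ρ) = x * Real.sqrt n / 3120 := by rw [hρ]; ring
    linarith
  unfold permProb
  rw [div_le_iff₀ hfac]
  refine hsub.trans ?_
  have h2q0 : (0 : ℝ) < 2 ^ q := by positivity
  refine le_of_mul_le_mul_right (hmain.trans ?_) h2q0
  calc (n.factorial : ℝ) * Real.exp (2 * ρ) ^ (c - a)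
      ≤ n.factorial * Real.exp (x * Real.sqrt n / 1000) := by gcongr
    _ = Real.exp (-(1 / 1000) * x * Real.sqrt n) * n.factorial *
          Real.exp (x * Real.sqrt n / 500) := by
        rw [mul_right_comm, ← Real.exp_add, mul_comm]
        congr 2
        ring
    _ ≤ _ := by gcongr

theorem choose_half_add_ge {N t : ℕ} (ht : (t : ℝ) + 1 ≤ Real.sqrt N / 100) :
    (2 : ℝ) ^ N / (4 * Real.sqrt N) ≤ (N.choose (N - N / 2 + t) : ℝ) := by
  have hs : Real.sqrt N ^ 2 = N := Real.sq_sqrt (by positivity)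
  have ht0 : (0 : ℝ) ≤ t := by positivity
  have hsq : ((t : ℝ) + 1) ^ 2 ≤ N / 10000 := by nlinarith
  have hsq' : (t + 1) ^ 2 * 10000 ≤ N := by
    have : ((t : ℝ) + 1) ^ 2 * 10000 ≤ N := by linarith
    exact_mod_cast this
  have hN : t + 1 ≤ (t + 1) ^ 2 := by nlinarith
  have hspos : 0 < Real.sqrt N := by linarith
  have key : ∀ h t' : ℕ, 1 ≤ h → t' ≤ t + 1 → 2 * h ≤ N → N ≤ 2 * h + 1 →
      (4 : ℝ) ^ h / (4 * Real.sqrt N) ≤ (2 * h).choose (h + t') := by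
    intro h t' hh htt h2 h3
    have hh' : (1 : ℝ) ≤ h := by exact_mod_cast hh
    have h1 := choose_add_ge h t' (by omega)
    have h4 : (t' : ℝ) ^ 2 / h ≤ 1 / 2 := by
      rw [div_le_iff₀ (by linarith)]
      have e1 : (t' : ℝ) ≤ t + 1 := by exact_mod_cast htt
      have e2 : (N : ℝ) ≤ 2 * h + 1 := by exact_mod_cast h3
      have e3 : (t' : ℝ) ^ 2 ≤ (t + 1) ^ 2 := by gcongr
      linarith
    have h5 := centralBinom_mul_sqrt_ge hh
    have h6 : Real.sqrt h ≤ Real.sqrt N := by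
      refine Real.sqrt_le_sqrt ?_
      exact_mod_cast (by omega : h ≤ N)
    have h7 : (0 : ℝ) ≤ h.centralBinom := by positivity
    rw [div_le_iff₀ (by positivity)]
    have h8 : (1 / 2 : ℝ) * h.centralBinom ≤ (2 * h).choose (h + t') := by
      refine le_trans ?_ h1
      gcongr
      linarith
    calc (4 : ℝ) ^ h ≤ 2 * Real.sqrt h * h.centralBinom := h5
      _ ≤ 2 * Real.sqrt N * h.centralBinom := by gcongr
      _ = (1 / 2 * h.centralBinom) * (4 * Real.sqrt N) := by ring
      _ ≤ _ := by gcongr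
  obtain ⟨h, rfl | rfl⟩ := Nat.even_or_odd' N
  · have := key h t (by omega) (by omega) le_rfl (by omega)
    rw [show 2 * h - 2 * h / 2 + t = h + t by omega, pow_mul]
    norm_num at this ⊢
    exact this
  · have k1 := key h t (by omega) (by omega) (by omega) le_rfl
    have k2 := key h (t + 1) (by omega) le_rfl (by omega) le_rfl
    rw [show 2 * h + 1 - (2 * h + 1) / 2 + t = (h + t) + 1 by omega, Nat.choose_succ_succ]
    rw [← add_assoc] at k2
    have h9 : (2 : ℝ) ^ (2 * h + 1) / (4 * Real.sqrt ((2 * h + 1 : ℕ) : ℝ))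
        = 4 ^ h / (4 * Real.sqrt ((2 * h + 1 : ℕ) : ℝ))
          + 4 ^ h / (4 * Real.sqrt ((2 * h + 1 : ℕ) : ℝ)) := by
      rw [pow_succ, pow_mul]; norm_num; ring
    rw [h9]
    exact (add_le_add k1 k2).trans_eq (Nat.cast_add _ _).symm

open Finset in
open Classical in
theorem card_midL_ge {N : ℕ} (hN : 200 ≤ Real.sqrt N) :
    (2 : ℝ) ^ N / 800 ≤ #{x : Pt N | midL N (wt x)} := by
  set T : ℕ := ⌊Real.sqrt N / 100⌋₊ with hT
  have hT1 : Real.sqrt N / 200 ≤ T := by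
    have := Nat.lt_floor_add_one (Real.sqrt N / 100)
    linarith
  have hT2 : (T : ℝ) ≤ Real.sqrt N / 100 := Nat.floor_le (by positivity)
  have hlev : ∀ t < T, (t : ℝ) + 1 ≤ Real.sqrt N / 100 := by
    intro t ht
    refine le_trans ?_ hT2
    exact_mod_cast ht
  have hmid : ∀ t < T, midL N (N - N / 2 + t) := by
    intro t ht
    have h1 := hlev t ht
    have h2 : (N : ℝ) ≤ 2 * ((N - N / 2 : ℕ) : ℝ) := by
      exact_mod_cast (by omega : N ≤ 2 * (N - N / 2))
    have h3 : 2 * ((N - N / 2 : ℕ) : ℝ) ≤ N + 1 := by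
      exact_mod_cast (by omega : 2 * (N - N / 2) ≤ N + 1)
    have ht0 : (0 : ℝ) ≤ t := by positivity
    rw [midL, abs_le, Nat.cast_add]
    constructor <;> linarith
  have hcard : ∑ t ∈ range T, N.choose (N - N / 2 + t) ≤ #{x : Pt N | midL N (wt x)} := by
    simp only [← card_filter_wt_eq]
    rw [← Finset.card_biUnion]
    · refine Finset.card_le_card fun x hx => ?_
      simp only [mem_biUnion, mem_range, Finset.mem_filter, Finset.mem_univ, true_and] at hx ⊢
      obtain ⟨t, ht, hx⟩ := hx
      rw [hx]; exact hmid t ht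
    · intro t _ t' _ htt
      rw [Function.onFun, Finset.disjoint_filter]
      intro x _ h1 h2
      omega
  have hspos : 0 < Real.sqrt N := by linarith
  calc (2 : ℝ) ^ N / 800 = Real.sqrt N / 200 * (2 ^ N / (4 * Real.sqrt N)) := by
        field_simp; norm_num
    _ ≤ T * (2 ^ N / (4 * Real.sqrt N)) := by gcongr
    _ = ∑ t ∈ range T, (2 : ℝ) ^ N / (4 * Real.sqrt N) := by simp
    _ ≤ ∑ t ∈ range T, (N.choose (N - N / 2 + t) : ℝ) :=
        Finset.sum_le_sum fun t ht => choose_half_add_ge (hlev t (mem_range.1 ht))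
    _ ≤ _ := by exact_mod_cast hcard

theorem wt_chainOf {m l : ℕ} (hl : l ≤ m) (τ : Equiv.Perm (Fin m)) : wt (chainOf τ l) = l := by
  have : wt (chainOf τ l) = Finset.card {t : Fin m | (t : ℕ) < l} := by
    unfold wt chainOf
    refine Finset.card_equiv τ.symm fun j => ?_
    simp
  rw [this, Fin.card_filter_val_lt, min_eq_right hl]

theorem plt_chainOf {m l l' : ℕ} (h : l < l') (hl : l' ≤ m) (τ : Equiv.Perm (Fin m)) :
    plt (chainOf τ l) (chainOf τ l') := by
  refine ⟨fun j => Bool.le_iff_imp.2 (monotone_chainOf τ h.le j), fun he => ?_⟩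
  have h1 := wt_chainOf (h.le.trans hl) τ
  rw [he, wt_chainOf hl] at h1
  omega

open Finset in
theorem card_chainOf_eq {m : ℕ} (y : Pt m) :
    #{τ : Equiv.Perm (Fin m) | chainOf τ (wt y) = y} = (wt y).factorial * (m - wt y).factorial := by
  have h := Numbering.card_prefixed (X := Fin m) {j | y j = true}
  rw [Fintype.card_fin] at h
  change _ = (wt y).factorial * (m - wt y).factorial at h
  rw [← h]
  let c := finCongr (Fintype.card_fin m).symm
  refine Finset.card_equiv
    (⟨fun τ => τ.symm.trans c, fun e => (e.trans c.symm).symm, fun τ => by ext; simp,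
      fun e => by ext; simp⟩ : Equiv.Perm (Fin m) ≃ Numbering (Fin m)) fun τ => ?_
  simp only [Finset.mem_filter, Finset.mem_univ, true_and, Numbering.mem_prefixed,
    Numbering.IsPrefix, funext_iff]
  refine forall_congr' fun j => ?_
  rw [Bool.eq_iff_iff, chainOf, decide_eq_true_eq]
  exact iff_comm

open Finset in
theorem sum_chainOf {m : ℕ} (F : Pt m → ℝ) :
    ∑ τ : Equiv.Perm (Fin m), ∑ l ∈ range (m + 1), (m.choose l : ℝ) * F (chainOf τ l)
      = m.factorial * ∑ y : Pt m, F y := by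
  rw [Finset.sum_comm,
    ← Finset.sum_fiberwise_of_maps_to (s := univ) (t := range (m + 1)) (g := wt) (f := F)
      (fun y _ => mem_range.2 (Nat.lt_succ_of_le (wt_le y))), Finset.mul_sum]
  refine Finset.sum_congr rfl fun l hl => ?_
  have hl : l ≤ m := Nat.le_of_lt_succ (mem_range.1 hl)
  rw [← Finset.mul_sum,
    ← Finset.sum_fiberwise_of_maps_to (s := univ) (t := {y : Pt m | wt y = l})
      (g := fun τ => chainOf τ l)
      (fun τ _ => by simpa using wt_chainOf hl τ), Finset.mul_sum, Finset.mul_sum]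
  refine Finset.sum_congr rfl fun y hy => ?_
  obtain rfl : wt y = l := (Finset.mem_filter.1 hy).2
  rw [Finset.sum_congr rfl (g := fun _ => F y)
    (fun τ hτ => by rw [(Finset.mem_filter.1 hτ).2]), Finset.sum_const, card_chainOf_eq,
    nsmul_eq_mul, ← mul_assoc, ← Nat.choose_mul_factorial_mul_factorial hl]
  push_cast
  ring

open Finset in
open Classical in
/-- An `s`-monotone function disagrees on a full chain with a balanced-blocks function throughout
at least `s` of the `3 s` blocks. -/
theorem IsBBPartition.card_bad_blocks {m s : ℕ} {b : ℕ → ℕ} (hb : IsBBPartition m (3 * s) b)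
    {h : Pt m → Bool} (hh : IsKMono s h) (τ : Equiv.Perm (Fin m)) :
    s ≤ #{i ∈ range (3 * s) | ∀ l, b i ≤ l → l < b (i + 1) →
      h (chainOf τ l) ≠ decide (Even i)} := by
  set good : ℕ → Prop := fun i =>
    ∃ l, b i ≤ l ∧ l < b (i + 1) ∧ h (chainOf τ l) = decide (Even i) with hgood
  have hbad : ∀ i, ¬ good i →
      ∀ l, b i ≤ l → l < b (i + 1) → h (chainOf τ l) ≠ decide (Even i) :=
    fun i hi l h1 h2 h3 => hi ⟨l, h1, h2, h3⟩
  set bad := {i ∈ range (3 * s) | ∀ l, b i ≤ l → l < b (i + 1) →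
      h (chainOf τ l) ≠ decide (Even i)} with hbadset
  set J := {j ∈ range (3 * s / 2) | good (2 * j) ∧ good (2 * j + 1)} with hJ
  have h1 : #{j ∈ range (3 * s / 2) | ¬ (good (2 * j) ∧ good (2 * j + 1))} ≤ #bad := by
    refine Finset.card_le_card_of_injOn
      (fun j => if good (2 * j) then 2 * j + 1 else 2 * j) ?_ ?_
    · intro j hj
      have hj' := Finset.mem_filter.1 hj
      have hjr := mem_range.1 hj'.1
      by_cases hg : good (2 * j)
      · simp only [hg, if_true]
        exact Finset.mem_filter.2
          ⟨mem_range.2 (by omega), hbad _ fun hg' => hj'.2 ⟨hg, hg'⟩⟩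
      · simp only [hg, if_false]
        exact Finset.mem_filter.2 ⟨mem_range.2 (by omega), hbad _ hg⟩
    · intro j _ j' _ hjj
      simp only at hjj
      split_ifs at hjj <;> omega
  have h2 := Finset.card_filter_add_card_filter_not (s := range (3 * s / 2))
    (fun j => good (2 * j) ∧ good (2 * j + 1))
  have hJcard : #J = #{j ∈ range (3 * s / 2) | good (2 * j) ∧ good (2 * j + 1)} := by
    rw [hJ]
  rw [card_range] at h2
  suffices h3 : 2 * #J ≤ s by omega
  by_contra! hlt
  refine hh ?_
  choose! l hl1 hl2 hl3 using fun i (hi : good i) => hi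
  have hfin : {x | x ∈ J}.Finite := J.finite_toSet
  have hcard : #hfin.toFinset = #J := by congr 1; ext; simp
  set e : ℕ → ℕ := Nat.nth (· ∈ J) with he
  have heJ : ∀ j < #J, e j ∈ J := fun j hj => Nat.nth_mem_of_lt_card hfin (by rwa [hcard])
  have hemono : ∀ j j', j < j' → j' < #J → e j < e j' := fun j j' hjj hj =>
    Nat.nth_lt_nth_of_lt_card hfin hjj (by rwa [hcard])
  set idx : ℕ → ℕ := fun i => 2 * e (i / 2) + i % 2 with hidx
  have hidxgood : ∀ i ≤ s, good (idx i) ∧ idx i < 3 * s := by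
    intro i hi
    have hj := Finset.mem_filter.1 (heJ (i / 2) (by omega))
    have hjr := mem_range.1 hj.1
    rcases Nat.mod_two_eq_zero_or_one i with h0 | h0
    · simp only [hidx, h0]
      exact ⟨hj.2.1, by omega⟩
    · simp only [hidx, h0]
      exact ⟨hj.2.2, by omega⟩
  have hidxlt : ∀ i < s, idx i < idx (i + 1) := by
    intro i hi
    simp only [hidx]
    rcases Nat.mod_two_eq_zero_or_one i with h0 | h0
    · rw [show (i + 1) / 2 = i / 2 by omega]; omega
    · have := hemono (i / 2) ((i + 1) / 2) (by omega) (by omega)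
      omega
  have hval : ∀ i ≤ s, h (chainOf τ (l (idx i))) = decide (Even i) := by
    intro i hi
    rw [hl3 _ (hidxgood i hi).1, Bool.eq_iff_iff, decide_eq_true_iff, decide_eq_true_iff,
      Nat.even_iff, Nat.even_iff]
    simp only [hidx]
    omega
  refine ⟨fun i => chainOf τ (l (idx i)), fun i hi => plt_chainOf ?_ ?_ τ, ?_, fun i hi => ?_⟩
  · have e1 := hl2 _ (hidxgood i hi.le).1
    have e2 := hl1 _ (hidxgood (i + 1) hi).1
    have e3 := hb.mono (Nat.succ_le_of_lt (hidxlt i hi)) (hidxgood (i + 1) hi).2.le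
    rw [Nat.succ_eq_add_one] at e3
    omega
  · have e1 := hl2 _ (hidxgood (i + 1) hi).1
    have e3 := hb.mono (Nat.succ_le_of_lt (hidxgood (i + 1) hi).2) le_rfl
    rw [hb.2.1, Nat.succ_eq_add_one] at e3
    omega
  · simpa using hval 0 (by omega)
  · simp only [hval i hi.le, hval (i + 1) hi, Nat.even_add_one, decide_not]
    cases decide (Even i) <;> simp

open Finset in
theorem IsBBPartition.sum_blocks {m ℓ : ℕ} {b : ℕ → ℕ} (hb : IsBBPartition m ℓ b) (F : ℕ → ℝ) :
    ∑ i ∈ range ℓ, ∑ l ∈ Finset.Ico (b i) (b (i + 1)), F l = ∑ l ∈ range (m + 1), F l := by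
  have key : ∀ j ≤ ℓ, ∑ i ∈ range j, ∑ l ∈ Finset.Ico (b i) (b (i + 1)), F l
      = ∑ l ∈ range (b j), F l := by
    intro j
    induction j with
    | zero => simp [hb.1]
    | succ j ih =>
      intro hj
      rw [Finset.sum_range_succ, ih (by omega),
        Finset.sum_range_add_sum_Ico _ (hb.2.2.1 j (by omega)).le]
  rw [key ℓ le_rfl, hb.2.1]

open Finset in
/-- The balanced-blocks function on `3 s` blocks is far from every `s`-monotone function. -/
theorem IsBBPartition.card_ne_ge {m s : ℕ} (hs : 0 < s) (hm : 6 * (s : ℝ) ≤ Real.sqrt m)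
    {b : ℕ → ℕ} (hb : IsBBPartition m (3 * s) b) {BB : Pt m → Bool}
    (hBB : IsBBFun m (3 * s) b BB) {h : Pt m → Bool} (hh : IsKMono s h) :
    (2 : ℝ) ^ m / 6 ≤ #{y : Pt m | BB y ≠ h y} := by
  classical
  set F : Pt m → ℝ := fun y => if BB y ≠ h y then 1 else 0 with hF
  have hF0 : ∀ y, 0 ≤ F y := fun y => by simp only [hF]; split_ifs <;> norm_num
  have hs' : (0 : ℝ) < s := by exact_mod_cast hs
  have hchain : ∀ τ : Equiv.Perm (Fin m),
      (2 : ℝ) ^ m / 6 ≤ ∑ l ∈ range (m + 1), (m.choose l : ℝ) * F (chainOf τ l) := by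
    intro τ
    set bad := {i ∈ range (3 * s) | ∀ l, b i ≤ l → l < b (i + 1) →
      h (chainOf τ l) ≠ decide (Even i)} with hbad
    have hcard := hb.card_bad_blocks hh τ
    rw [← hb.sum_blocks]
    calc (2 : ℝ) ^ m / 6 = s * (2 ^ m / (6 * s)) := by field_simp
      _ ≤ #bad * (2 ^ m / (6 * s)) := by gcongr
      _ = ∑ i ∈ bad, (2 : ℝ) ^ m / (6 * s) := by simp
      _ ≤ ∑ i ∈ bad, ∑ l ∈ Finset.Ico (b i) (b (i + 1)),
            (m.choose l : ℝ) * F (chainOf τ l) := by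
          refine Finset.sum_le_sum fun i hi => ?_
          obtain ⟨hi1, hi2⟩ := Finset.mem_filter.1 hi
          have hi1 := mem_range.1 hi1
          refine (hb.block_ge hs hm hi1).trans (le_of_eq ?_)
          refine Finset.sum_congr rfl fun l hl => ?_
          obtain ⟨hl1, hl2⟩ := Finset.mem_Ico.1 hl
          have hlm : l ≤ m := by
            have := hb.mono (Nat.succ_le_of_lt hi1) le_rfl
            rw [hb.2.1, Nat.succ_eq_add_one] at this
            omega
          have hw := wt_chainOf hlm τ
          have hBBl := hb.apply_eq hBB (y := chainOf τ l) hi1 (by rwa [hw]) (by rwa [hw])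
          have : F (chainOf τ l) = 1 := by
            simp only [hF]
            rw [if_pos]
            rw [hBBl]
            exact (hi2 l hl1 hl2).symm
          rw [this, mul_one]
      _ ≤ _ := Finset.sum_le_sum_of_subset_of_nonneg (Finset.filter_subset _ _)
          fun i _ _ => Finset.sum_nonneg fun l _ => mul_nonneg (by positivity) (hF0 _)
  have hsum := Finset.sum_le_sum fun τ (_ : τ ∈ (univ : Finset (Equiv.Perm (Fin m)))) => hchain τ
  rw [sum_chainOf, Finset.sum_const, Finset.card_univ, Fintype.card_perm, Fintype.card_fin,
    nsmul_eq_mul] at hsum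
  have h1 := le_of_mul_le_mul_left hsum (by positivity)
  refine h1.trans (le_of_eq ?_)
  simp only [hF]
  rw [Finset.sum_boole]

theorem wL_append {nL nR : ℕ} (x : Pt nL) (y : Pt nR) : wL nL (Fin.append x y) = wt x := by
  unfold wL wt
  refine (Finset.card_nbij (Fin.castAdd nR) ?_ ?_ ?_).symm
  · intro i hi
    simpa using hi
  · intro i _ j _ hij
    simpa using hij
  · intro i hi
    simp only [Finset.coe_filter, Finset.mem_univ, true_and, Set.mem_ofPred_eq] at hi
    refine ⟨⟨i, hi.1⟩, ?_, by ext; simp⟩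
    have h := hi.2
    rw [show i = Fin.castAdd nR ⟨i, hi.1⟩ by ext; simp, Fin.append_left] at h
    simpa using h

theorem yPart_append {nL nR : ℕ} (x : Pt nL) (y : Pt nR) :
    yPart nL nR rfl (Fin.append x y) = y := by
  funext j
  exact Fin.append_right x y j

theorem IsKMono.append_comp {s nL nR : ℕ} {g : Pt (nL + nR) → Bool} (hg : IsKMono s g)
    (σ : Equiv.Perm (Fin (nL + nR))) (x : Pt nL) :
    IsKMono s (fun y : Pt nR => g (fun i => Fin.append x y (σ i))) := by
  rintro ⟨p, hp, h0, halt⟩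
  refine hg ⟨fun t i => Fin.append x (p t) (σ i), fun t ht => ⟨fun i => ?_, fun he => ?_⟩, h0, halt⟩
  · change Fin.append x (p t) (σ i) ≤ Fin.append x (p (t + 1)) (σ i)
    induction σ i using Fin.addCases with
    | left j => simp
    | right j => simpa using (hp t ht).1 j
  · refine (hp t ht).2 (funext fun j => ?_)
    have := congrFun he (σ.symm (Fin.natAdd nL j))
    simpa using this

open Finset in
theorem hdist_hardFun_ge {s n nR nL : ℕ} (hs : 0 < s) (hsum : nL + nR = n)
    (hm : 6 * (s : ℝ) ≤ Real.sqrt nR) (hL : 200 ≤ Real.sqrt nL) {b : ℕ → ℕ} {BB : Pt nR → Bool}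
    (hb : IsBBPartition nR (3 * s) b) (hBB : IsBBFun nR (3 * s) b BB) {f : Pt n → Bool}
    (hf : IsHardFun nL nR hsum BB f) (σ : Equiv.Perm (Fin n)) {g : Pt n → Bool}
    (hg : IsKMono s g) :
    1 / 4800 ≤ hdist (fun z => f (fun i => z (σ i))) g := by
  classical
  subst hsum
  set M : Finset (Pt nL) := {x : Pt nL | midL nL (wt x)} with hM
  set D : Pt nL → Finset (Pt nR) := fun x =>
    {y : Pt nR | BB y ≠ g (fun i => Fin.append x y (σ.symm i))} with hD
  have hcard : #(M.sigma D) ≤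
      {z : Pt (nL + nR) | f (fun i => z (σ i)) ≠ g z}.ncard := by
    rw [← Set.ncard_coe_finset]
    refine Set.ncard_le_ncard_of_injOn
      (fun p => fun i => Fin.append p.1 p.2 (σ.symm i)) ?_ ?_ (Set.toFinite _)
    · rintro ⟨x, y⟩ hxy
      obtain ⟨hx, hy⟩ := Finset.mem_sigma.1 (Finset.mem_coe.1 hxy)
      have hx := (Finset.mem_filter.1 hx).2
      have hy := (Finset.mem_filter.1 hy).2
      have hfz := (hf (Fin.append x y)).1 (by rw [wL_append]; exact hx)
      rw [yPart_append] at hfz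
      simp only [Set.mem_ofPred_eq, Equiv.symm_apply_apply]
      change f (Fin.append x y) ≠ _
      rwa [hfz]
    · rintro ⟨x, y⟩ _ ⟨x', y'⟩ _ hxy
      have h : Fin.append x y = Fin.append x' y' := by
        funext i
        simpa using congrFun hxy (σ i)
      have h1 : x = x' := funext fun i => by simpa using congrFun h (Fin.castAdd nR i)
      have h2 : y = y' := funext fun i => by simpa using congrFun h (Fin.natAdd nL i)
      rw [h1, h2]
  unfold hdist
  rw [le_div_iff₀ (by positivity)]
  refine le_trans ?_ (Nat.cast_le.2 hcard)
  rw [Finset.card_sigma, Nat.cast_sum]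
  calc (1 / 4800 : ℝ) * 2 ^ (nL + nR) = (2 ^ nL / 800) * (2 ^ nR / 6) := by rw [pow_add]; ring
    _ ≤ #M * (2 ^ nR / 6) := by
        have := card_midL_ge hL
        gcongr
    _ = ∑ x ∈ M, (2 : ℝ) ^ nR / 6 := by simp
    _ ≤ _ := Finset.sum_le_sum fun x _ =>
        hb.card_ne_ge hs hm hBB (hg.append_comp σ.symm x)

/-- There are absolute constants `ε₀ > 0`, `C > 0`, `N₀` such that for every
even `k ≥ 2`, every `s ≥ k`, and all positive `n, n_R` with `k²·n = 625·s²·n_R`,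
`n_L = n − n_R`, `N₀·s ≤ √n_R` and `n ≥ N₀·r⁴` (where `r = s/k`), the hard function `f`
built from any balanced-blocks function on `{0,1}^{n_R}` with `3s` blocks satisfies,
for every permutation `σ` of `Fin n`:
(i) `d(f ∘ π_σ, g) ≥ ε₀` for every `s`-monotone `g`, and
(ii) a uniformly random maximal chain contains a violation of `k`-monotonicity of
`f ∘ π_σ` with probability at most `exp(−C·(k²/s²)·√n)`. -/
theorem stmt0 :
    ∃ ε₀ : ℝ, 0 < ε₀ ∧ ∃ C : ℝ, 0 < C ∧ ∃ N₀ : ℕ,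
      ∀ (k s n nR nL : ℕ), 2 ≤ k → Even k → k ≤ s → 0 < n → 0 < nR →
        k ^ 2 * n = 625 * s ^ 2 * nR → nL = n - nR →
        ∀ hsum : nL + nR = n,
        ((N₀ : ℝ) * s ≤ Real.sqrt nR) →
        ((N₀ : ℝ) * ((s : ℝ) / k) ^ 4 ≤ (n : ℝ)) →
        ∀ (b : ℕ → ℕ) (BB : Pt nR → Bool),
          IsBBPartition nR (3 * s) b → IsBBFun nR (3 * s) b BB →
          ∀ f : Pt n → Bool, IsHardFun nL nR hsum BB f →
            ∀ σ : Equiv.Perm (Fin n),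
              (∀ g : Pt n → Bool, IsKMono s g →
                  ε₀ ≤ hdist (fun z => f (fun i => z (σ i))) g) ∧
              permProb n (fun τ =>
                  ChainViol k (fun z => f (fun i => z (σ i))) (chainOf τ)) ≤
                Real.exp (-C * ((k : ℝ) ^ 2 / (s : ℝ) ^ 2) * Real.sqrt n) := by
  refine ⟨1 / 4800, by norm_num, 1 / 1000, by norm_num, 100, ?_⟩
  intro k s n nR nL hk hke hks _ _ hn _ hsum hN _ b BB hb hBB f hf σ
  have hs : 0 < s := by omega
  have hs1 : (2 : ℝ) ≤ s := by exact_mod_cast hk.trans hks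
  push_cast at hN
  have hm : 6 * (s : ℝ) ≤ Real.sqrt nR := by linarith
  have hle : nR ≤ nL := by
    have h1 : k ^ 2 ≤ s ^ 2 := Nat.pow_le_pow_left hks 2
    have h2 : k ^ 2 * n ≤ s ^ 2 * n := Nat.mul_le_mul_right _ h1
    have h3 : s ^ 2 * (625 * nR) ≤ s ^ 2 * n := by linarith
    have h4 := le_of_mul_le_mul_left h3 (by positivity)
    omega
  have hL : 200 ≤ Real.sqrt nL := by
    have : Real.sqrt nR ≤ Real.sqrt nL := Real.sqrt_le_sqrt (by exact_mod_cast hle)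
    linarith
  exact ⟨fun g hg => hdist_hardFun_ge hs hsum hm hL hb hBB hf σ hg,
    permProb_chainViol_le hk hke hks hn hsum hN hb hBB hf σ⟩
end

section
/- Let k ≥ 2 be an even integer and s an integer with s ≥ k, and set r = s/k. There exist absolute constants C > 0 and N₀ such that the following holds. Suppose n and n_R are positive integers with k²·n = 625·s²·n_R, n_L = n − n_R, 12·s ≤ √n_R, and n ≥ N₀·r⁴, and let f be the hard function built from any balanced-blocks function on (Fin n_R → Bool) with 3s blocks. Then the probability that a uniformly random maximal chain in {0,1}^n contains a violation of k-monotonicity of f is at most exp(−C·(k²/s²)·√n). -/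
/-- The number of positions `p < i` at which `c` is `true`. -/
def prefixCount {n : ℕ} (c : Pt n) (i : ℕ) : ℕ :=
  (Finset.univ.filter (fun p : Fin n => (p : ℕ) < i ∧ c p = true)).card

theorem prefixCount_mono {n : ℕ} (c : Pt n) {i j : ℕ} (h : i ≤ j) :
    prefixCount c i ≤ prefixCount c j := by
  unfold prefixCount
  apply Finset.card_le_card
  intro p
  simp only [Finset.mem_filter, Finset.mem_univ, true_and]
  exact fun hp => ⟨hp.1.trans_le h, hp.2⟩

theorem card_fin_lt {n i : ℕ} (h : i ≤ n) :
    (Finset.univ.filter (fun p : Fin n => (p : ℕ) < i)).card = i := by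
  rw [← Finset.card_range i]
  refine Finset.card_bij (fun p _ => (p : ℕ)) ?_ ?_ ?_
  · intro p hp; simpa using hp
  · intro p _ q _ hpq; exact Fin.ext hpq
  · intro j hj
    have hj' : j < i := by simpa using hj
    exact ⟨⟨j, hj'.trans_le h⟩, by simpa using hj', rfl⟩

theorem prefixCount_add_not {n i : ℕ} (c : Pt n) (h : i ≤ n) :
    prefixCount c i + prefixCount (fun p => !c p) i = i := by
  conv_rhs => rw [← card_fin_lt h]
  unfold prefixCount
  rw [← Finset.card_union_of_disjoint]
  · congr 1
    ext p
    simp only [Finset.mem_union, Finset.mem_filter, Finset.mem_univ, true_and]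
    cases c p <;> simp
  · rw [Finset.disjoint_left]
    intro p
    simp only [Finset.mem_filter, Finset.mem_univ, true_and]
    cases c p <;> simp

/-- Reversal of the first `q` positions of `Fin n` (the identity if `q > n`). -/
def prefixRev (n q : ℕ) (p : Fin n) : Fin n :=
  if h : (p : ℕ) < q ∧ q ≤ n then ⟨q - 1 - p, by omega⟩ else p

theorem prefixRev_val_of_lt {n q : ℕ} {p : Fin n} (hp : (p : ℕ) < q) (hq : q ≤ n) :
    (prefixRev n q p : ℕ) = q - 1 - p := by
  simp [prefixRev, hp, hq]

theorem prefixRev_of_le {n q : ℕ} {p : Fin n} (hp : q ≤ (p : ℕ)) :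
    prefixRev n q p = p := by
  have : ¬ ((p : ℕ) < q ∧ q ≤ n) := by omega
  simp [prefixRev, this]

theorem prefixRev_involutive (n q : ℕ) : Function.Involutive (prefixRev n q) := by
  intro p
  by_cases h : (p : ℕ) < q ∧ q ≤ n
  · have h1 := prefixRev_val_of_lt h.1 h.2
    have h2 : (prefixRev n q p : ℕ) < q := by omega
    apply Fin.ext
    rw [prefixRev_val_of_lt h2 h.2, h1]
    omega
  · have : prefixRev n q p = p := by simp [prefixRev, h]
    rw [this, this]

theorem prefixCount_prefixRev_of_ge {n q i : ℕ} (c : Pt n) (hq : q ≤ n) (h : q ≤ i) :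
    prefixCount (fun p => c (prefixRev n q p)) i = prefixCount c i := by
  unfold prefixCount
  have key : ∀ p : Fin n, (p : ℕ) < i → (prefixRev n q p : ℕ) < i := by
    intro p hp
    by_cases hpq : (p : ℕ) < q
    · rw [prefixRev_val_of_lt hpq hq]; omega
    · rwa [prefixRev_of_le (by omega)]
  refine Finset.card_bij (fun p _ => prefixRev n q p) ?_ ?_ ?_
  · intro p hp
    simp only [Finset.mem_filter, Finset.mem_univ, true_and] at hp ⊢
    exact ⟨key p hp.1, hp.2⟩
  · intro p _ p' _ hpp
    exact (prefixRev_involutive n q).injective hpp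
  · intro p hp
    simp only [Finset.mem_filter, Finset.mem_univ, true_and] at hp
    refine ⟨prefixRev n q p, ?_, prefixRev_involutive n q p⟩
    simp only [Finset.mem_filter, Finset.mem_univ, true_and, prefixRev_involutive n q p]
    exact ⟨key p hp.1, hp.2⟩

theorem prefixCount_prefixRev_add {n q i : ℕ} (c : Pt n) (hq : q ≤ n) (h : i ≤ q) :
    prefixCount (fun p => c (prefixRev n q p)) i + prefixCount c (q - i) = prefixCount c q := by
  have h1 : prefixCount (fun p => c (prefixRev n q p)) i =
      (Finset.univ.filter (fun p : Fin n => (q - i ≤ (p : ℕ) ∧ (p : ℕ) < q) ∧ c p = true)).card := by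
    unfold prefixCount
    refine Finset.card_bij (fun p _ => prefixRev n q p) ?_ ?_ ?_
    · intro p hp
      simp only [Finset.mem_filter, Finset.mem_univ, true_and] at hp ⊢
      have := prefixRev_val_of_lt (hp.1.trans_le h) hq
      exact ⟨by omega, hp.2⟩
    · intro p _ p' _ hpp
      exact (prefixRev_involutive n q).injective hpp
    · intro p hp
      simp only [Finset.mem_filter, Finset.mem_univ, true_and] at hp
      refine ⟨prefixRev n q p, ?_, prefixRev_involutive n q p⟩
      simp only [Finset.mem_filter, Finset.mem_univ, true_and, prefixRev_involutive n q p]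
      have := prefixRev_val_of_lt hp.1.2 hq
      exact ⟨by omega, hp.2⟩
  rw [h1]
  unfold prefixCount
  rw [← Finset.card_union_of_disjoint]
  · congr 1
    ext p
    simp only [Finset.mem_union, Finset.mem_filter, Finset.mem_univ, true_and]
    constructor
    · rintro (⟨h, h'⟩ | ⟨h, h'⟩) <;> exact ⟨by omega, h'⟩
    · rintro ⟨h, h'⟩
      by_cases hp : (p : ℕ) < q - i
      · exact Or.inr ⟨hp, h'⟩
      · exact Or.inl ⟨by omega, h'⟩
  · rw [Finset.disjoint_left]
    intro p
    simp only [Finset.mem_filter, Finset.mem_univ, true_and]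
    intro h h'
    omega

/-- The length of the longest prefix on which `c` takes the value `true` at most `M` times. -/
def cutoff {n : ℕ} (M : ℕ) (c : Pt n) : ℕ :=
  Nat.findGreatest (fun i => prefixCount c i ≤ M) n

theorem cutoff_le {n : ℕ} (M : ℕ) (c : Pt n) : cutoff M c ≤ n := Nat.findGreatest_le n

theorem prefixCount_cutoff_le {n : ℕ} (M : ℕ) (c : Pt n) :
    prefixCount c (cutoff M c) ≤ M :=
  Nat.findGreatest_spec (P := fun i => prefixCount c i ≤ M) (m := 0) (Nat.zero_le n)
    (by simp [prefixCount])

theorem le_cutoff {n M i : ℕ} {c : Pt n} (hi : i ≤ n) (h : prefixCount c i ≤ M) :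
    i ≤ cutoff M c := Nat.le_findGreatest hi h

theorem cutoff_prefixRev {n : ℕ} (M : ℕ) (c : Pt n) :
    cutoff M (fun p => c (prefixRev n (cutoff M c) p)) = cutoff M c := by
  set q := cutoff M c with hq
  have hqn : q ≤ n := cutoff_le M c
  set q' := cutoff M (fun p => c (prefixRev n q p)) with hq'
  have h1 : q ≤ q' := le_cutoff hqn (by
    rw [prefixCount_prefixRev_of_ge c hqn le_rfl]; exact prefixCount_cutoff_le M c)
  refine le_antisymm (le_cutoff (cutoff_le _ _) ?_) h1
  rw [← prefixCount_prefixRev_of_ge c hqn h1]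
  exact prefixCount_cutoff_le M _

/-- The positions occupied by elements of `L` in the order given by `σ`. -/
def leftPos {n : ℕ} (nL : ℕ) (σ : Equiv.Perm (Fin n)) : Pt n := fun p => decide ((σ p : ℕ) < nL)

/-- Reversal of the part of the order `σ` preceding the `(M+1)`-st element of `L`. -/
def reflect {n : ℕ} (nL M : ℕ) (σ : Equiv.Perm (Fin n)) : Equiv.Perm (Fin n) :=
  (prefixRev_involutive n (cutoff M (leftPos nL σ))).toPerm.trans σ

theorem leftPos_reflect {n : ℕ} (nL M : ℕ) (σ : Equiv.Perm (Fin n)) :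
    leftPos nL (reflect nL M σ) =
      fun p => leftPos nL σ (prefixRev n (cutoff M (leftPos nL σ)) p) := rfl

theorem reflect_involutive {n : ℕ} (nL M : ℕ) :
    Function.Involutive (reflect (n := n) nL M) := by
  intro σ
  ext p
  have h := cutoff_prefixRev M (leftPos nL σ)
  rw [← leftPos_reflect] at h
  change ((σ (prefixRev n _ (prefixRev n (cutoff M (leftPos nL (reflect nL M σ))) p)) : Fin n) : ℕ)
    = _
  rw [h, prefixRev_involutive]

/-- After reflection, a window holding few elements of `L` and many others becomes a prefix. -/
theorem prefixCount_not_reflect {n nL a W A t u : ℕ} (σ : Equiv.Perm (Fin n)) (htu : t ≤ u)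
    (hu : u ≤ n) (hL : a ≤ prefixCount (leftPos nL σ) t)
    (hL' : prefixCount (leftPos nL σ) u ≤ a + W)
    (hR : prefixCount (fun p => !leftPos nL σ p) t + A ≤
      prefixCount (fun p => !leftPos nL σ p) u) :
    A ≤ prefixCount (fun p => !leftPos nL (reflect nL (a + W) σ) p) (W + A) := by
  set c := leftPos nL σ with hc
  set q := cutoff (a + W) c with hq
  have hqn : q ≤ n := cutoff_le _ _
  have huq : u ≤ q := le_cutoff hu hL'
  have e1 := prefixCount_prefixRev_add c hqn (Nat.sub_le q t)
  have e2 := prefixCount_prefixRev_add (fun p => !c p) hqn (Nat.sub_le q t)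
  rw [Nat.sub_sub_self (htu.trans huq)] at e1 e2
  have h1 : prefixCount c q ≤ a + W := prefixCount_cutoff_le _ _
  have h2 := prefixCount_mono (fun p => !c p) huq
  change A ≤ prefixCount (fun p => !c (prefixRev n q p)) (W + A)
  by_cases hcase : q - t ≤ W + A
  · have := prefixCount_mono (fun p => !c (prefixRev n q p)) hcase
    omega
  · have h3 := prefixCount_mono (fun p => c (prefixRev n q p)) (not_le.mp hcase).le
    have h4 := prefixCount_add_not (fun p => c (prefixRev n q p)) (i := W + A) (by omega)
    beta_reduce at h4
    omega

theorem card_perm_mapsTo_le {n : ℕ} (S B B' : Finset (Fin n)) (h : B.card = B'.card) :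
    (Finset.univ.filter (fun σ : Equiv.Perm (Fin n) => ∀ p ∈ B, σ p ∈ S)).card ≤
      (Finset.univ.filter (fun σ : Equiv.Perm (Fin n) => ∀ p ∈ B', σ p ∈ S)).card := by
  let e : {x // x ∈ B'} ≃ {x // x ∈ B} := Finset.equivOfCardEq h.symm
  refine Finset.card_le_card_of_injOn (fun σ => σ * e.extendSubtype) ?_ ?_
  · intro σ hσ
    simp only [Finset.coe_filter, Finset.mem_univ, true_and, Set.mem_ofPred_eq] at hσ ⊢
    intro p hp
    exact hσ _ (e.extendSubtype_mem p hp)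
  · intro σ _ τ _ hστ
    exact mul_right_cancel hστ

theorem card_perm_mapsTo {n : ℕ} (S B : Finset (Fin n)) :
    (Finset.univ.filter (fun σ : Equiv.Perm (Fin n) => ∀ p ∈ B, σ p ∈ S)).card *
      n.choose B.card = n.factorial * S.card.choose B.card := by
  have h1 : ∑ B' ∈ Finset.powersetCard B.card (Finset.univ : Finset (Fin n)),
      (Finset.univ.filter (fun σ : Equiv.Perm (Fin n) => ∀ p ∈ B', σ p ∈ S)).card =
      (Finset.univ.filter (fun σ : Equiv.Perm (Fin n) => ∀ p ∈ B, σ p ∈ S)).card *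
      n.choose B.card := by
    rw [Finset.sum_congr rfl (g := fun _ => (Finset.univ.filter
      (fun σ : Equiv.Perm (Fin n) => ∀ p ∈ B, σ p ∈ S)).card)]
    · simp [Finset.card_powersetCard, mul_comm]
    · intro B' hB'
      have := (Finset.mem_powersetCard.mp hB').2
      exact le_antisymm (card_perm_mapsTo_le S _ _ this) (card_perm_mapsTo_le S _ _ this.symm)
  rw [← h1]
  refine (Finset.sum_card_bipartiteAbove_eq_sum_card_bipartiteBelow (t := Finset.univ)
    (fun (B' : Finset (Fin n)) (σ : Equiv.Perm (Fin n)) => ∀ p ∈ B', σ p ∈ S)).trans ?_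
  rw [Finset.sum_congr rfl (g := fun _ => S.card.choose B.card)]
  · simp [Fintype.card_perm]
  · intro σ _
    rw [← Finset.card_map (σ.symm.toEmbedding) (s := S), ← Finset.card_powersetCard]
    congr 1
    ext B'
    simp only [Finset.bipartiteBelow, Finset.mem_filter, Finset.mem_powersetCard,
      true_and, Finset.subset_iff, Finset.mem_map_equiv, Equiv.symm_symm,
      Finset.mem_univ, implies_true]
    exact and_comm

/-- A union bound for the hypergeometric tail. -/
theorem card_perm_prefixCount_le {n nL : ℕ} (T A : ℕ) (h : nL ≤ n) :
    (Finset.univ.filter (fun σ : Equiv.Perm (Fin n) =>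
        A ≤ prefixCount (fun p => !leftPos nL σ p) T)).card * n.choose A ≤
      T.choose A * (n.factorial * (n - nL).choose A) := by
  set S : Finset (Fin n) := Finset.univ.filter (fun x : Fin n => nL ≤ (x : ℕ)) with hS
  have hScard : S.card = n - nL := by
    have := Finset.card_filter_add_card_filter_not (s := (Finset.univ : Finset (Fin n)))
      (fun p : Fin n => (p : ℕ) < nL)
    rw [card_fin_lt h] at this
    rw [Finset.card_univ, Fintype.card_fin] at this
    have e : S = Finset.univ.filter (fun x : Fin n => ¬ (x : ℕ) < nL) := by ext; simp [hS]
    rw [e]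
    omega
  set Q : Finset (Fin n) := Finset.univ.filter (fun x : Fin n => (x : ℕ) < T) with hQ
  have hQcard : Q.card ≤ T := by
    rw [← Finset.card_range T]
    exact Finset.card_le_card_of_injOn (fun p => (p : ℕ)) (fun p hp => by simpa [hQ] using hp)
      (fun p _ q _ h => Fin.ext h)
  have hsub : (Finset.univ.filter (fun σ : Equiv.Perm (Fin n) =>
        A ≤ prefixCount (fun p => !leftPos nL σ p) T)) ⊆
      (Finset.powersetCard A Q).biUnion (fun B =>
        Finset.univ.filter (fun σ : Equiv.Perm (Fin n) => ∀ p ∈ B, σ p ∈ S)) := by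
    intro σ hσ
    simp only [Finset.mem_filter, Finset.mem_univ, true_and] at hσ
    obtain ⟨B, hB, hBc⟩ := Finset.exists_subset_card_eq hσ
    simp only [Finset.mem_biUnion, Finset.mem_powersetCard]
    refine ⟨B, ⟨fun p hp => ?_, hBc⟩, ?_⟩
    · have := hB hp
      simp only [Finset.mem_filter, Finset.mem_univ, true_and] at this
      simpa [hQ] using this.1
    · simp only [Finset.mem_filter, Finset.mem_univ, true_and]
      intro p hp
      have := hB hp
      simp only [Finset.mem_filter, Finset.mem_univ, true_and] at this
      simpa [hS, leftPos] using this.2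
  calc _ ≤ (∑ B ∈ Finset.powersetCard A Q, (Finset.univ.filter
          (fun σ : Equiv.Perm (Fin n) => ∀ p ∈ B, σ p ∈ S)).card) * n.choose A :=
        Nat.mul_le_mul_right _ ((Finset.card_le_card hsub).trans Finset.card_biUnion_le)
    _ = ∑ B ∈ Finset.powersetCard A Q, n.factorial * (n - nL).choose A := by
        rw [Finset.sum_mul]
        refine Finset.sum_congr rfl fun B hB => ?_
        have hBc := (Finset.mem_powersetCard.mp hB).2
        have := card_perm_mapsTo S B
        rwa [hBc, hScard] at this
    _ = Q.card.choose A * (n.factorial * (n - nL).choose A) := by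
        simp [Finset.card_powersetCard]
    _ ≤ _ := Nat.mul_le_mul_right _ (Nat.choose_le_choose A hQcard)

theorem wL_chainOf_s1 {n : ℕ} (nL i : ℕ) (σ : Equiv.Perm (Fin n)) :
    wL nL (chainOf σ i) = prefixCount (leftPos nL σ) i := by
  unfold wL prefixCount
  refine Finset.card_bij (fun p _ => σ.symm p) ?_ ?_ ?_
  · intro p hp; simpa [chainOf, leftPos, and_comm] using hp
  · intro p _ q _ h; exact σ.symm.injective h
  · intro p hp
    exact ⟨σ p, by simpa [chainOf, leftPos, and_comm] using hp, by simp⟩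

theorem wt_yPart_chainOf {n nL nR : ℕ} (hsum : nL + nR = n) (i : ℕ) (σ : Equiv.Perm (Fin n)) :
    wt (yPart nL nR hsum (chainOf σ i)) = prefixCount (fun p => !leftPos nL σ p) i := by
  unfold wt prefixCount
  refine Finset.card_bij (fun j _ => σ.symm ⟨nL + (j : ℕ), by omega⟩) ?_ ?_ ?_
  · intro p hp; simpa [chainOf, leftPos, yPart] using hp
  · intro p _ q _ h
    have := congrArg Fin.val (σ.symm.injective h)
    simp only at this
    exact Fin.ext (by omega)
  · intro p hp
    simp only [Finset.mem_filter, Finset.mem_univ, true_and, leftPos, Bool.not_eq_true',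
      decide_eq_false_iff_not, not_lt] at hp
    have hlt := (σ p).isLt
    refine ⟨⟨(σ p : ℕ) - nL, by omega⟩, ?_, ?_⟩
    · simp only [Finset.mem_filter, Finset.mem_univ, true_and, yPart, chainOf, decide_eq_true_eq]
      have : (⟨nL + ((σ p : ℕ) - nL), by omega⟩ : Fin n) = σ p := Fin.ext (by simp; omega)
      rw [this]; simpa using hp.1
    · have : (⟨nL + ((σ p : ℕ) - nL), by omega⟩ : Fin n) = σ p := Fin.ext (by simp; omega)
      simp only [this, Equiv.symm_apply_apply]

theorem centralBinom_sq_mul_le (n : ℕ) : n.centralBinom ^ 2 * (2 * n + 1) ≤ 16 ^ n := by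
  induction n with
  | zero => simp
  | succ n ih =>
    have h := Nat.succ_mul_centralBinom_succ n
    refine le_of_mul_le_mul_left ?_ (pow_pos n.succ_pos 2)
    rw [Nat.succ_eq_add_one]
    calc (n + 1) ^ 2 * ((n + 1).centralBinom ^ 2 * (2 * (n + 1) + 1))
        = ((n + 1) * (n + 1).centralBinom) ^ 2 * (2 * n + 3) := by ring
      _ = 4 * (2 * n + 1) * (2 * n + 3) * (n.centralBinom ^ 2 * (2 * n + 1)) := by rw [h]; ring
      _ ≤ 4 * (2 * n + 1) * (2 * n + 3) * 16 ^ n := Nat.mul_le_mul_left _ ih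
      _ ≤ (16 * (n + 1) ^ 2) * 16 ^ n := Nat.mul_le_mul_right _ (by nlinarith)
      _ = _ := by ring

theorem choose_half_sq_mul_le (m : ℕ) : (m.choose (m / 2)) ^ 2 * m ≤ 4 ^ m := by
  rcases Nat.even_or_odd' m with ⟨n, rfl | rfl⟩
  · have h := centralBinom_sq_mul_le n
    rw [Nat.centralBinom] at h
    have e : 2 * n / 2 = n := by omega
    rw [e, pow_mul]
    norm_num
    nlinarith [sq_nonneg ((2 * n).choose n)]
  · have h := centralBinom_sq_mul_le (n + 1)
    have e : (2 * n + 1) / 2 = n := by omega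
    have h2 : (n + 1).centralBinom = 2 * (2 * n + 1).choose n := by
      rw [Nat.centralBinom, show 2 * (n + 1) = (2 * n + 1) + 1 by ring, Nat.choose_succ_succ,
        Nat.choose_symm_half]
      ring
    rw [h2] at h
    have h4 : (4 : ℕ) ^ (2 * n + 1) = 16 ^ n * 4 := by rw [pow_succ, pow_mul]; norm_num
    rw [pow_succ 16 n] at h
    rw [e, h4]
    nlinarith [sq_nonneg ((2 * n + 1).choose n)]

theorem ncard_levels_le (m a d : ℕ) :
    (({y : Pt m | a ≤ wt y ∧ wt y < a + d}.ncard : ℕ) : ℝ) * Real.sqrt m ≤ d * 2 ^ m := by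
  have h1 : {y : Pt m | a ≤ wt y ∧ wt y < a + d}.ncard ≤
      ∑ j ∈ Finset.Ico a (a + d), m.choose j := by
    have e : ∑ j ∈ Finset.Ico a (a + d), m.choose j = ((Finset.Ico a (a + d)).biUnion
        (fun j => Finset.powersetCard j (Finset.univ : Finset (Fin m)))).card := by
      rw [Finset.card_biUnion]
      · simp [Finset.card_powersetCard]
      · intro i _ j _ hij
        exact Finset.pairwise_disjoint_powersetCard _ hij
    rw [e, ← Set.ncard_coe_finset]
    refine Set.ncard_le_ncard_of_injOn
      (fun y => Finset.univ.filter (fun i => y i = true)) ?_ ?_ (Finset.finite_toSet _)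
    · intro y hy
      simpa [wt, Finset.mem_powersetCard] using hy
    · intro y _ z _ hyz
      funext i
      have := congrArg (fun s => i ∈ s) hyz
      simpa using this
  calc _ ≤ ((∑ j ∈ Finset.Ico a (a + d), m.choose j : ℕ) : ℝ) * Real.sqrt m := by gcongr
    _ = ∑ j ∈ Finset.Ico a (a + d), (m.choose j : ℝ) * Real.sqrt m := by
        push_cast; rw [Finset.sum_mul]
    _ ≤ ∑ j ∈ Finset.Ico a (a + d), (2 : ℝ) ^ m :=
        Finset.sum_le_sum fun j _ => choose_mul_sqrt_le m j
    _ = _ := by simp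

/-- Every block of a balanced-blocks partition into `3s` blocks spans at least `√m/(4s)` levels. -/
theorem IsBBPartition.width {m s : ℕ} {b : ℕ → ℕ} (hb : IsBBPartition m (3 * s) b) (hs : 0 < s)
    (hm : (12 : ℝ) * s ≤ Real.sqrt m) {i : ℕ} (hi : i < 3 * s) :
    (b i : ℝ) + Real.sqrt m / (4 * s) ≤ b (i + 1) := by
  obtain ⟨-, -, hmono, hsize⟩ := hb
  have h1 := (hsize i hi).1
  have hs' : (0 : ℝ) < s := by exact_mod_cast hs
  have hpos : 0 < Real.sqrt m := by linarith
  obtain ⟨d, hd⟩ := Nat.exists_eq_add_of_lt (hmono i hi)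
  have hd' : b (i + 1) = b i + (d + 1) := by omega
  have h2 := ncard_levels_le m (b i) (d + 1)
  rw [hd'] at h1 ⊢
  have h3 : (3 : ℝ) / 4 ≤ 1 - ((3 * s : ℕ) : ℝ) / Real.sqrt m := by
    have : ((3 * s : ℕ) : ℝ) / Real.sqrt m ≤ 1 / 4 := by
      rw [div_le_iff₀ hpos]; push_cast; linarith
    linarith
  have h4 : (3 : ℝ) / 4 * 2 ^ m / ((3 * s : ℕ) : ℝ) * Real.sqrt m ≤ ((d + 1 : ℕ) : ℝ) * 2 ^ m := by
    refine le_trans ?_ h2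
    refine mul_le_mul_of_nonneg_right (le_trans ?_ h1) hpos.le
    gcongr
  have h5 : Real.sqrt m / (4 * s) * 2 ^ m ≤ ((d + 1 : ℕ) : ℝ) * 2 ^ m := by
    refine le_trans (le_of_eq ?_) h4
    push_cast
    field_simp
  have h6 := le_of_mul_le_mul_right h5 (by positivity)
  push_cast at h6 ⊢
  linarith

theorem IsBBPartition.le_of_le {m ℓ : ℕ} {b : ℕ → ℕ} (hb : IsBBPartition m ℓ b) {i j : ℕ}
    (hij : i ≤ j) (hj : j ≤ ℓ) : b i ≤ b j := by
  induction j, hij using Nat.le_induction with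
  | base => exact le_rfl
  | succ j _ ih => exact (ih (by omega)).trans (hb.2.2.1 j (by omega)).le

theorem exists_block_of_lt {b : ℕ → ℕ} (h0 : b 0 = 0) {ℓ v : ℕ} (hv : v < b ℓ) :
    ∃ i < ℓ, b i ≤ v ∧ v < b (i + 1) := by
  induction ℓ with
  | zero => omega
  | succ ℓ ih =>
    by_cases h : v < b ℓ
    · obtain ⟨i, hi, h'⟩ := ih h
      exact ⟨i, by omega, h'⟩
    · exact ⟨ℓ, by omega, not_lt.mp h, hv⟩

theorem IsBBPartition.exists_block {m ℓ : ℕ} {b : ℕ → ℕ} (hb : IsBBPartition m ℓ b) (y : Pt m) :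
    ∃ i < ℓ, b i ≤ wt y ∧ wt y < b (i + 1) := by
  refine exists_block_of_lt hb.1 ?_
  rw [hb.2.1, Nat.lt_succ_iff]
  exact (Finset.card_le_univ _).trans (by simp)

theorem IsBBPartition.block_le {m ℓ : ℕ} {b : ℕ → ℕ} (hb : IsBBPartition m ℓ b) {i j v w : ℕ}
    (hi : i < ℓ) (hvw : v ≤ w) (hv : b i ≤ v) (hw : w < b (j + 1)) : i ≤ j := by
  by_contra! h
  have := hb.le_of_le (show j + 1 ≤ i by omega) hi.le
  omega

theorem IsBBFun.eq_of_same_block {m ℓ : ℕ} {b : ℕ → ℕ} {BB : Pt m → Bool}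
    (hb : IsBBPartition m ℓ b) (hBB : IsBBFun m ℓ b BB) {i : ℕ} (hi : i < ℓ) {y z : Pt m}
    (hy : b i ≤ wt y ∧ wt y < b (i + 1)) (hz : b i ≤ wt z ∧ wt z < b (i + 1)) :
    BB y = BB z := by
  have key : ∀ u : Pt m, b i ≤ wt u ∧ wt u < b (i + 1) → (BB u = true ↔ Even i) := by
    intro u hu
    rw [hBB u]
    constructor
    · rintro ⟨j, hj, he, hju⟩
      have : i = j := le_antisymm (hb.block_le hi le_rfl hu.1 hju.2)
        (hb.block_le hj le_rfl hju.1 hu.2)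
      rwa [this]
    · exact fun he => ⟨i, hi, he, hu⟩
  rw [Bool.eq_iff_iff, key y hy, key z hz]

/-- Alternating `k` times along increasing weights moves up by at least `k` blocks. -/
theorem IsBBFun.exists_blocks_of_alternating {m ℓ k : ℕ} {b : ℕ → ℕ} {BB : Pt m → Bool}
    (hb : IsBBPartition m ℓ b) (hBB : IsBBFun m ℓ b BB) (y : ℕ → Pt m)
    (hmono : ∀ i < k, wt (y i) ≤ wt (y (i + 1))) (halt : ∀ i < k, BB (y i) ≠ BB (y (i + 1))) :
    ∃ i, i + k < ℓ ∧ wt (y 0) < b (i + 1) ∧ b (i + k) ≤ wt (y k) := by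
  obtain ⟨i, hi, hi'⟩ := hb.exists_block (y 0)
  have key : ∀ j ≤ k, ∃ j' < ℓ, i + j ≤ j' ∧ b j' ≤ wt (y j) ∧ wt (y j) < b (j' + 1) := by
    intro j
    induction j with
    | zero => exact fun _ => ⟨i, hi, le_rfl, hi'⟩
    | succ j ih =>
      intro hj
      obtain ⟨j', hj', hle, hblk⟩ := ih (by omega)
      obtain ⟨l, hl, hlblk⟩ := hb.exists_block (y (j + 1))
      have h1 := hb.block_le hj' (hmono j hj) hblk.1 hlblk.2
      refine ⟨l, hl, ?_, hlblk⟩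
      rcases h1.eq_or_lt with rfl | h
      · exact absurd (hBB.eq_of_same_block hb hj' hblk hlblk) (halt j hj)
      · omega
  obtain ⟨j', hj', hle, hblk⟩ := key k le_rfl
  exact ⟨i, by omega, hi'.2, (hb.le_of_le hle hj'.le).trans hblk.1⟩

theorem IsBBPartition.width_mul {m s : ℕ} {b : ℕ → ℕ} (hb : IsBBPartition m (3 * s) b) (hs : 0 < s)
    (hm : (12 : ℝ) * s ≤ Real.sqrt m) (i d : ℕ) (hi : i + d ≤ 3 * s) :
    (b i : ℝ) + d * (Real.sqrt m / (4 * s)) ≤ b (i + d) := by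
  induction d with
  | zero => simp
  | succ d ih =>
    have h1 := ih (by omega)
    have h2 := hb.width hs hm (i := i + d) (by omega)
    rw [← add_assoc]
    push_cast
    linarith

theorem midL_of_le_of_le {nL u v w : ℕ} (hu : midL nL u) (hw : midL nL w) (huv : u ≤ v)
    (hvw : v ≤ w) : midL nL v := by
  unfold midL at *
  rw [abs_le] at *
  have h1 : (u : ℝ) ≤ v := by exact_mod_cast huv
  have h2 : (v : ℝ) ≤ w := by exact_mod_cast hvw
  exact ⟨by linarith, by linarith⟩

theorem midL.bounds {nL w : ℕ} (h : midL nL w) :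
    ⌈(nL : ℝ) / 2 - Real.sqrt nL / 100⌉₊ ≤ w ∧
      w ≤ ⌈(nL : ℝ) / 2 - Real.sqrt nL / 100⌉₊ + ⌊Real.sqrt nL / 50⌋₊ := by
  unfold midL at h
  rw [abs_le] at h
  have h1 : ⌈(nL : ℝ) / 2 - Real.sqrt nL / 100⌉₊ ≤ w := Nat.ceil_le.mpr (by linarith)
  refine ⟨h1, ?_⟩
  have h2 := Nat.le_ceil ((nL : ℝ) / 2 - Real.sqrt nL / 100)
  have h3 : w - ⌈(nL : ℝ) / 2 - Real.sqrt nL / 100⌉₊ ≤ ⌊Real.sqrt nL / 50⌋₊ := by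
    refine Nat.le_floor ?_
    rw [Nat.cast_sub h1]
    linarith
  omega

/-- A violation on the chain of `σ` forces the `R`-weight to advance by the width of `k - 1`
blocks while the `L`-weight stays in the middle window. -/
theorem exists_window_of_chainViol {k s n nR nL : ℕ} (hk : Even k) (hs : 0 < s)
    (hsum : nL + nR = n) (hm : (12 : ℝ) * s ≤ Real.sqrt nR) {b : ℕ → ℕ} {BB : Pt nR → Bool}
    (hb : IsBBPartition nR (3 * s) b) (hBB : IsBBFun nR (3 * s) b BB) {f : Pt n → Bool}
    (hf : IsHardFun nL nR hsum BB f) {σ : Equiv.Perm (Fin n)}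
    (hv : ChainViol k f (chainOf σ)) :
    ∃ t u, t ≤ u ∧ u ≤ n ∧ midL nL (prefixCount (leftPos nL σ) t) ∧
      midL nL (prefixCount (leftPos nL σ) u) ∧
      (prefixCount (fun p => !leftPos nL σ p) t : ℝ) + (k - 1) * (Real.sqrt nR / (4 * s)) ≤
        prefixCount (fun p => !leftPos nL σ p) u := by
  obtain ⟨t, htlt, htn, h0, halt⟩ := hv
  have tmono : ∀ j ≤ k, ∀ i ≤ j, t i ≤ t j := by
    intro j
    induction j with
    | zero => intro _ i hi; rw [Nat.le_zero.mp hi]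
    | succ j ih =>
      intro hj i hi
      rcases hi.eq_or_lt with rfl | h
      · exact le_rfl
      · exact (ih (by omega) i (by omega)).trans (htlt j (by omega)).le
  have hpar : ∀ i ≤ k, (f (chainOf σ (t i)) = true ↔ Even i) := by
    intro i
    induction i with
    | zero => simp [h0]
    | succ i ih =>
      intro hi
      have h1 := ih (by omega)
      have h2 := halt i (by omega)
      rw [Nat.even_add_one, ← h1]
      revert h2
      cases f (chainOf σ (t i)) <;> cases f (chainOf σ (t (i + 1))) <;> simp
  have hmid : ∀ z : Pt n, f z = true → midL nL (wL nL z) := by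
    intro z hz
    by_contra h
    rw [(hf z).2 h] at hz
    exact Bool.false_ne_true hz
  have m0 := hmid _ h0
  have mk := hmid _ ((hpar k le_rfl).mpr hk)
  rw [wL_chainOf_s1] at m0 mk
  have hmidi : ∀ i ≤ k, f (chainOf σ (t i)) = BB (yPart nL nR hsum (chainOf σ (t i))) := by
    intro i hi
    refine (hf _).1 ?_
    rw [wL_chainOf_s1]
    exact midL_of_le_of_le m0 mk (prefixCount_mono _ (tmono i hi 0 (Nat.zero_le i)))
      (prefixCount_mono _ (tmono k le_rfl i hi))
  obtain ⟨i, hi, hlo, hhi⟩ := hBB.exists_blocks_of_alternating (k := k) hb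
    (fun i => yPart nL nR hsum (chainOf σ (t i)))
    (fun i hi => by
      rw [wt_yPart_chainOf, wt_yPart_chainOf]; exact prefixCount_mono _ (htlt i hi).le)
    (fun i hi => by
      rw [← hmidi i (by omega), ← hmidi (i + 1) (by omega)]; exact halt i hi)
  rw [wt_yPart_chainOf] at hlo hhi
  refine ⟨t 0, t k, tmono k le_rfl 0 (Nat.zero_le k), htn k le_rfl, m0, mk, ?_⟩
  rcases Nat.eq_zero_or_pos k with rfl | hkpos
  · have : 0 ≤ Real.sqrt nR / (4 * s) := by positivity
    push_cast
    linarith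
  · have h1 := hb.width_mul hs hm (i + 1) (k - 1) (by omega)
    rw [show i + 1 + (k - 1) = i + k by omega, Nat.cast_sub hkpos] at h1
    have h2 : (prefixCount (fun p => !leftPos nL σ p) (t 0) : ℝ) ≤ b (i + 1) := by
      exact_mod_cast hlo.le
    have h3 : (b (i + k) : ℝ) ≤ prefixCount (fun p => !leftPos nL σ p) (t k) := by
      exact_mod_cast hhi
    push_cast at h1
    linarith

theorem choose_mul_choose_le_exp {n m T A : ℕ} (hA : 0 < A) (hAn : 2 * A ≤ n)
    (h : 15 * (T : ℝ) * m ≤ A * n) :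
    (T.choose A : ℝ) * m.choose A ≤ Real.exp (-A) * n.choose A := by
  have hA' : (0 : ℝ) < A := by exact_mod_cast hA
  have hfac : (0 : ℝ) < A.factorial := by exact_mod_cast A.factorial_pos
  have h1 : (T.choose A : ℝ) ≤ (T : ℝ) ^ A / A.factorial := Nat.choose_le_pow_div A T
  have h2 : (m.choose A : ℝ) ≤ (m : ℝ) ^ A / A.factorial := Nat.choose_le_pow_div A m
  have h3 : ((n : ℝ) / 2) ^ A / A.factorial ≤ n.choose A := by
    rw [div_le_iff₀ hfac]
    have h4 : (n + 1 - A) ^ A ≤ n.choose A * A.factorial := by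
      rw [mul_comm, ← Nat.descFactorial_eq_factorial_mul_choose]
      exact Nat.pow_sub_le_descFactorial n A
    refine le_trans ?_ (by exact_mod_cast h4 : (((n + 1 - A : ℕ) : ℝ)) ^ A ≤ _)
    gcongr
    rw [Nat.cast_sub (by omega)]
    have : (2 : ℝ) * A ≤ n := by exact_mod_cast hAn
    push_cast
    linarith
  have h4 : (A : ℝ) ^ A / A.factorial ≤ Real.exp A := Real.pow_div_factorial_le_exp _ hA'.le A
  have he : Real.exp 1 * Real.exp 1 ≤ 15 / 2 := by
    have := Real.exp_one_lt_d9
    have := Real.exp_pos 1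
    nlinarith
  have h5 : (T : ℝ) * m / A ≤ Real.exp (-1) * Real.exp (-1) * (n / 2) := by
    rw [div_le_iff₀ hA', Real.exp_neg]
    have hinv : (2 : ℝ) / 15 ≤ (Real.exp 1)⁻¹ * (Real.exp 1)⁻¹ := by
      rw [← mul_inv, show (2 : ℝ) / 15 = (15 / 2)⁻¹ by norm_num]
      exact inv_anti₀ (by positivity) he
    have hn : (0 : ℝ) ≤ A * n := by positivity
    nlinarith
  calc (T.choose A : ℝ) * m.choose A
      ≤ ((T : ℝ) ^ A / A.factorial) * ((m : ℝ) ^ A / A.factorial) := by gcongr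
    _ = ((T : ℝ) * m / A) ^ A * ((A : ℝ) ^ A / A.factorial) / A.factorial := by
        rw [div_pow, mul_pow]
        field_simp
    _ ≤ (Real.exp (-1) * Real.exp (-1) * (n / 2)) ^ A * Real.exp A / A.factorial := by gcongr
    _ = Real.exp (-A) * (((n : ℝ) / 2) ^ A / A.factorial) := by
        have e1 : Real.exp (-1) ^ A = Real.exp (-A) := by
          rw [← Real.exp_nat_mul]; congr 1; ring
        have e2 : Real.exp (-A) * Real.exp A = 1 := by rw [← Real.exp_add]; simp
        rw [mul_pow, mul_pow, e1]
        calc _ = Real.exp (-A) * (Real.exp (-A) * Real.exp A) * ((n : ℝ) / 2) ^ A / A.factorial := by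
              ring
          _ = _ := by rw [e2]; ring
    _ ≤ _ := by gcongr

theorem permProb_le_exp {n nL a W A : ℕ} (hnL : nL ≤ n) (hA : 0 < A) (hAn : 2 * A ≤ n)
    (h : 15 * ((W + A : ℕ) : ℝ) * ((n - nL : ℕ) : ℝ) ≤ A * n) {P : Equiv.Perm (Fin n) → Prop}
    (hP : ∀ σ, P σ → ∃ t u, t ≤ u ∧ u ≤ n ∧ a ≤ prefixCount (leftPos nL σ) t ∧
      prefixCount (leftPos nL σ) u ≤ a + W ∧
      prefixCount (fun p => !leftPos nL σ p) t + A ≤ prefixCount (fun p => !leftPos nL σ p) u) :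
    permProb n P ≤ Real.exp (-A) := by
  unfold permProb
  rw [div_le_iff₀ (by exact_mod_cast n.factorial_pos)]
  have h1 : {σ : Equiv.Perm (Fin n) | P σ}.ncard ≤
      (Finset.univ.filter (fun σ : Equiv.Perm (Fin n) =>
        A ≤ prefixCount (fun p => !leftPos nL σ p) (W + A))).card := by
    rw [← Set.ncard_coe_finset]
    refine Set.ncard_le_ncard_of_injOn (reflect nL (a + W)) ?_
      (reflect_involutive nL (a + W)).injective.injOn (Finset.finite_toSet _)
    intro σ hσ
    obtain ⟨t, u, htu, hu, hL, hL', hR⟩ := hP σ hσ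
    simpa using prefixCount_not_reflect σ htu hu hL hL' hR
  have h2 := (Nat.mul_le_mul_right (n.choose A) h1).trans
    (card_perm_prefixCount_le (W + A) A hnL)
  have h3 := choose_mul_choose_le_exp hA hAn h
  have hc : (0 : ℝ) < n.choose A := by
    exact_mod_cast Nat.choose_pos (show A ≤ n by omega)
  refine le_of_mul_le_mul_right ?_ hc
  refine (by exact_mod_cast h2 : _ ≤ (((W + A).choose A * (n.factorial * (n - nL).choose A) : ℕ)
    : ℝ)).trans ?_
  push_cast
  calc _ = (n.factorial : ℝ) * (((W + A).choose A : ℝ) * (n - nL).choose A) := by ring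
    _ ≤ (n.factorial : ℝ) * (Real.exp (-A) * n.choose A) := by gcongr
    _ = _ := by ring

/-- There are absolute constants `C > 0` and `N₀` such that for every even
`k ≥ 2`, every `s ≥ k`, and all positive `n, n_R` with `k²·n = 625·s²·n_R`, `n_L = n − n_R`,
`12·s ≤ √n_R` and `n ≥ N₀·r⁴` (where `r = s/k`), the probability that a uniformly random
maximal chain in `{0,1}^n` contains a violation of `k`-monotonicity of the hard function `f`
(built from any balanced-blocks function on `{0,1}^{n_R}` with `3s` blocks) is at most
`exp(−C·(k²/s²)·√n)`. -/
theorem stmt1 :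
    ∃ C : ℝ, 0 < C ∧ ∃ N₀ : ℕ,
      ∀ (k s n nR nL : ℕ), 2 ≤ k → Even k → k ≤ s → 0 < n → 0 < nR →
        k ^ 2 * n = 625 * s ^ 2 * nR → nL = n - nR →
        ∀ hsum : nL + nR = n,
        ((12 : ℝ) * s ≤ Real.sqrt nR) →
        ((N₀ : ℝ) * ((s : ℝ) / k) ^ 4 ≤ (n : ℝ)) →
        ∀ (b : ℕ → ℕ) (BB : Pt nR → Bool),
          IsBBPartition nR (3 * s) b → IsBBFun nR (3 * s) b BB →
          ∀ f : Pt n → Bool, IsHardFun nL nR hsum BB f →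
            permProb n (fun σ => ChainViol k f (chainOf σ)) ≤
              Real.exp (-C * ((k : ℝ) ^ 2 / (s : ℝ) ^ 2) * Real.sqrt n) := by
  refine ⟨1 / 200, by norm_num, 0, ?_⟩
  intro k s n nR nL hk2 hk hks hn hnR hrel hnL hsum hm _ b BB hb hBB f hf
  have hs : 0 < s := by omega
  have hs' : (0 : ℝ) < s := by exact_mod_cast hs
  have hk' : (2 : ℝ) ≤ k := by exact_mod_cast hk2
  have hks' : (k : ℝ) ≤ s := by exact_mod_cast hks
  have hrel' : (k : ℝ) ^ 2 * n = 625 * s ^ 2 * nR := by exact_mod_cast hrel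
  set q := Real.sqrt n with hq
  set w := Real.sqrt nR with hw
  have hqq : q ^ 2 = n := Real.sq_sqrt (Nat.cast_nonneg n)
  have hww : w ^ 2 = nR := Real.sq_sqrt (Nat.cast_nonneg nR)
  have hq0 : 0 ≤ q := Real.sqrt_nonneg _
  have hw0 : 0 ≤ w := Real.sqrt_nonneg _
  have hq1 : 1 ≤ q := Real.one_le_sqrt.mpr (by exact_mod_cast hn)
  have hkq : (k : ℝ) * q = 25 * s * w := by
    refine (pow_left_inj₀ (by positivity) (by positivity) two_ne_zero).mp ?_
    rw [mul_pow, mul_pow, mul_pow, hqq, hww, hrel']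
    norm_num
  set x := (k : ℝ) ^ 2 * q / (200 * s ^ 2) with hx
  have hx1 : 1 ≤ x := by
    rw [hx, le_div_iff₀ (by positivity)]
    have : 300 * (s : ℝ) ^ 2 ≤ k * q := by rw [hkq]; nlinarith
    nlinarith
  have hxq : x ≤ q / 200 := by
    rw [hx, div_le_div_iff₀ (by positivity) (by norm_num)]
    have : (k : ℝ) ^ 2 ≤ s ^ 2 := by gcongr
    nlinarith
  have hxA : x ≤ ⌈x⌉₊ := Nat.le_ceil x
  have hAx : (⌈x⌉₊ : ℝ) ≤ q / 100 := by
    have := Nat.ceil_lt_add_one (by linarith : 0 ≤ x)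
    linarith
  have hblocks : x ≤ (k - 1) * (w / (4 * s)) := by
    have hwq : w = k * q / (25 * s) := by rw [hkq]; field_simp
    rw [hwq, hx, show ((k : ℝ) - 1) * (k * q / (25 * s) / (4 * s)) =
      (2 * (k - 1) * k * q) / (200 * s ^ 2) by field_simp; ring]
    gcongr
    nlinarith
  have hW : ((⌊Real.sqrt nL / 50⌋₊ : ℕ) : ℝ) ≤ q / 50 := by
    refine (Nat.floor_le (by positivity)).trans ?_
    have : Real.sqrt nL ≤ q := Real.sqrt_le_sqrt (by exact_mod_cast (by omega : nL ≤ n))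
    linarith
  have hbound : permProb n (fun σ => ChainViol k f (chainOf σ)) ≤ Real.exp (-(⌈x⌉₊ : ℝ)) := by
    refine permProb_le_exp (a := ⌈(nL : ℝ) / 2 - Real.sqrt nL / 100⌉₊)
      (W := ⌊Real.sqrt nL / 50⌋₊) (by omega : nL ≤ n) (Nat.ceil_pos.mpr (by linarith)) ?_ ?_ ?_
    · have : (2 : ℝ) * ⌈x⌉₊ ≤ n := by rw [← hqq]; nlinarith
      exact_mod_cast this
    · rw [show n - nL = nR by omega]
      push_cast
      have hnRx : (nR : ℝ) = x * q * (200 / 625) := by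
        rw [hx, show (k : ℝ) ^ 2 * q / (200 * s ^ 2) * q * (200 / 625) =
          (k : ℝ) ^ 2 * q ^ 2 / (625 * s ^ 2) by field_simp, hqq, hrel']
        field_simp
      calc 15 * (((⌊Real.sqrt nL / 50⌋₊ : ℕ) : ℝ) + ⌈x⌉₊) * nR
          ≤ 15 * (q / 50 + q / 100) * nR := by gcongr
        _ = x * q ^ 2 * (15 * (3 / 100) * (200 / 625)) := by rw [hnRx]; ring
        _ ≤ x * q ^ 2 * 1 := by gcongr; norm_num
        _ ≤ ⌈x⌉₊ * n := by rw [hqq, mul_one]; gcongr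
    · intro σ hσ
      obtain ⟨t, u, htu, hu, h1, h2, h3⟩ :=
        exists_window_of_chainViol hk hs hsum hm hb hBB hf hσ
      refine ⟨t, u, htu, hu, h1.bounds.1, h2.bounds.2, ?_⟩
      have hmono := prefixCount_mono (fun p => !leftPos nL σ p) htu
      have : ⌈x⌉₊ ≤ prefixCount (fun p => !leftPos nL σ p) u -
          prefixCount (fun p => !leftPos nL σ p) t := by
        refine Nat.ceil_le.mpr ?_
        rw [Nat.cast_sub hmono]
        linarith
      omega
  refine hbound.trans (Real.exp_le_exp.mpr ?_)
  have : -(1 / 200 : ℝ) * ((k : ℝ) ^ 2 / (s : ℝ) ^ 2) * q = -x := by rw [hx]; field_simp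
  rw [this]
  linarith
end
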